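/- arXiv:1907.10123 — 4 statements merged into one kernel-verified Lean document; each statement's English description precedes it below -/
import Mathlib

section
/- Let n ≥ 1 and let τ_1,…,τ_n be transpositions of [n], say τ_i = (a_i b_i). Then the product τ_1τ_2⋯τ_n is a full cycle on [n] if and only if the n pairs {a_i, b_i} are pairwise distinct and form the edge set of a tree on the vertex set [n]. -/
open Finset

namespace Equiv.Perm

theorem SameCycle.rel_of_forall_rel_apply {α : Type*} {r : α → α → Prop} (hr : Equivalence r)
    {σ : Perm α} (h : ∀ x, r x (σ x)) {x y : α} (hxy : σ.SameCycle x y) : r x y := by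
  obtain ⟨i, rfl⟩ := hxy
  induction i using Int.induction_on with
  | zero => exact hr.refl x
  | succ i ih =>
    rw [add_comm, zpow_add, zpow_one, mul_apply]
    exact hr.trans ih (h _)
  | pred i ih =>
    refine hr.trans ih (hr.symm ?_)
    convert h ((σ ^ (-(i : ℤ) - 1)) x) using 1
    rw [← mul_apply, ← zpow_one_add]
    congr 2
    ring

variable {α : Type*} [DecidableEq α]

/-- The graph whose edges are the pairs exchanged by the transpositions in the list `l`. -/
def swapGraph (l : List (Perm α)) : SimpleGraph α :=
  SimpleGraph.fromRel fun a b => swap a b ∈ l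

theorem swapGraph_adj {l : List (Perm α)} {a b : α} :
    (swapGraph l).Adj a b ↔ a ≠ b ∧ swap a b ∈ l := by
  simp [swapGraph, swap_comm b a]

theorem swapGraph_cons {l : List (Perm α)} (a b : α) :
    swapGraph (swap a b :: l) = swapGraph l ⊔ SimpleGraph.edge a b := by
  ext x y
  simp only [swapGraph_adj, List.mem_cons, SimpleGraph.sup_adj, SimpleGraph.edge_adj]
  by_cases hxy : x = y
  · simp [hxy]
  · have : swap x y = swap a b ↔ (a = x ∧ b = y ∨ a = y ∧ b = x) := by
      constructor
      · intro h
        have hx := congrArg (· x) h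
        have hy := congrArg (· y) h
        simp only [swap_apply_left, swap_apply_right, swap_apply_def] at hx hy
        grind
      · rintro (⟨rfl, rfl⟩ | ⟨rfl, rfl⟩)
        · rfl
        · exact swap_comm _ _
    grind

theorem reachable_of_sameCycle_prod {l : List (Perm α)} (hl : ∀ s ∈ l, s.IsSwap) {x y : α}
    (h : l.prod.SameCycle x y) : (swapGraph l).Reachable x y := by
  refine h.rel_of_forall_rel_apply (SimpleGraph.reachable_is_equivalence _) fun z => ?_
  clear h
  induction l with
  | nil => simp
  | cons s l ih =>
    obtain ⟨a, b, hab, rfl⟩ := hl s (by simp)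
    have ih := ih fun s hs => hl s (by simp [hs])
    rw [swapGraph_cons]
    refine (ih.mono le_sup_left).trans ?_
    rw [List.prod_cons, mul_apply]
    have hadj : (swapGraph l ⊔ SimpleGraph.edge a b).Adj a b := by
      simp [SimpleGraph.edge_adj, hab]
    rw [swap_apply_def]
    split_ifs with h1 h2
    · rw [h1]; exact hadj.reachable
    · rw [h2]; exact hadj.reachable.symm
    · rfl

theorem sameCycle_swap_mul_of_not_sameCycle [Finite α] {σ : Perm α} {a b : α}
    (h : ¬ σ.SameCycle a b) : (swap a b * σ).SameCycle a b := by
  classical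
  have hex : ∃ k, 0 < k ∧ (σ ^ k) a = a :=
    ⟨orderOf σ, orderOf_pos σ, by rw [pow_orderOf_eq_one, one_apply]⟩
  obtain ⟨hpos, hk⟩ := Nat.find_spec hex
  have hlt : ∀ j < Nat.find hex, ((swap a b * σ) ^ j) a = (σ ^ j) a := by
    intro j hj
    induction j with
    | zero => rfl
    | succ j ih =>
      rw [pow_succ', pow_succ', mul_apply, ih (by lia), mul_apply, mul_apply, ← mul_apply σ,
        ← pow_succ']
      refine swap_apply_of_ne_of_ne (fun e => Nat.find_min hex hj ⟨j.succ_pos, e⟩) fun e => ?_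
      exact h ⟨(j + 1 : ℕ), by rw [zpow_natCast, e]⟩
  obtain ⟨k, hk'⟩ := Nat.exists_eq_add_one_of_ne_zero hpos.ne'
  refine ⟨(k + 1 : ℕ), ?_⟩
  rw [hk'] at hk hlt
  rw [zpow_natCast, pow_succ', mul_apply, hlt k (by lia), mul_apply, ← mul_apply σ, ← pow_succ',
    hk, swap_apply_left]

theorem SameCycle.swap_mul_of_not_sameCycle [Finite α] {σ : Perm α} {a b x y : α}
    (h : ¬ σ.SameCycle a b) (hxy : σ.SameCycle x y) : (swap a b * σ).SameCycle x y := by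
  refine hxy.rel_of_forall_rel_apply (SameCycle.equivalence _) fun z => ?_
  have hab := sameCycle_swap_mul_of_not_sameCycle h
  have hz : (swap a b * σ).SameCycle z (swap a b (σ z)) := by
    rw [← mul_apply, sameCycle_apply_right]
  refine hz.trans ?_
  rw [swap_apply_def]
  split_ifs with h1 h2
  · rw [h1]; exact hab.symm
  · rw [h2]; exact hab
  · rfl

theorem sameCycle_prod_of_reachable [Finite α] {l : List (Perm α)} (hl : ∀ s ∈ l, s.IsSwap)
    (hnd : l.Nodup) (hac : (swapGraph l).IsAcyclic) {x y : α}
    (h : (swapGraph l).Reachable x y) : l.prod.SameCycle x y := by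
  induction l generalizing x y with
  | nil =>
    obtain ⟨w⟩ := h
    cases w with
    | nil => rfl
    | cons hadj _ => simp [swapGraph_adj] at hadj
  | cons s l ih =>
    obtain ⟨a, b, hab, rfl⟩ := hl s (by simp)
    have hl' : ∀ s ∈ l, s.IsSwap := fun s hs => hl s (by simp [hs])
    rw [List.nodup_cons] at hnd
    rw [swapGraph_cons] at hac h
    have hac' := SimpleGraph.isAcyclic_sup_fromEdgeSet_iff.mp hac
    have hnot : ¬ l.prod.SameCycle a b := fun hc => by
      rcases hac'.2 (reachable_of_sameCycle_prod hl' hc) with e | e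
      · exact hab e
      · exact hnd.1 (swapGraph_adj.mp e).2
    rw [List.prod_cons]
    obtain ⟨w⟩ := h
    induction w with
    | nil => rfl
    | cons hadj _ ihw =>
      refine SameCycle.trans ?_ ihw
      rcases hadj with hadj | hadj
      · exact (ih hl' hnd.2 hac'.1 hadj.reachable).swap_mul_of_not_sameCycle hnot
      · have hc := sameCycle_swap_mul_of_not_sameCycle hnot
        rcases (SimpleGraph.edge_adj ..).mp hadj with ⟨⟨rfl, rfl⟩ | ⟨rfl, rfl⟩, _⟩
        exacts [hc, hc.symm]

theorem isCycle_and_support_eq_univ_iff [Fintype α] [Nontrivial α] {σ : Perm α} :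
    σ.IsCycle ∧ σ.support = univ ↔ ∀ x y, σ.SameCycle x y := by
  constructor
  · rintro ⟨hc, hs⟩ x y
    have hne (z : α) : σ z ≠ z := mem_support.mp (hs ▸ mem_univ z)
    exact hc.sameCycle (hne x) (hne y)
  · intro h
    have hne (z : α) : σ z ≠ z := fun hz => by
      obtain ⟨y, hy⟩ := exists_ne z
      exact hy ((h z y).eq_of_left hz).symm
    obtain ⟨x⟩ : Nonempty α := inferInstance
    exact ⟨⟨x, hne x, fun y _ => h x y⟩, eq_univ_of_forall fun z => mem_support.mpr (hne z)⟩

end Equiv.Perm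

open Equiv Equiv.Perm in
theorem card_edgeSet_fromRel_swap_le {α ι : Type*} [Fintype α] [DecidableEq α] [Fintype ι]
    (f : ι → Perm α) :
    Nat.card (SimpleGraph.fromRel fun a b => ∃ i, f i = swap a b).edgeSet ≤
      (univ.image fun i => (f i).support).card := by
  have hmem : ∀ e ∈ (SimpleGraph.fromRel fun a b => ∃ i, f i = swap a b).edgeSet,
      e.toFinset ∈ univ.image fun i => (f i).support := by
    intro e
    induction e with | _ a b
    rw [SimpleGraph.mem_edgeSet, SimpleGraph.fromRel_adj, mem_image]
    rintro ⟨hab, ⟨i, hi⟩ | ⟨i, hi⟩⟩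
    · exact ⟨i, mem_univ i, by rw [hi, support_swap hab, Sym2.toFinset_mk_eq]⟩
    · exact ⟨i, mem_univ i, by rw [hi, swap_comm, support_swap hab, Sym2.toFinset_mk_eq]⟩
  rw [← Nat.card_eq_finsetCard]
  refine Nat.card_le_card_of_injective (fun e => ⟨e.1.toFinset, hmem e.1 e.2⟩) fun e₁ e₂ h => ?_
  refine Subtype.ext (Sym2.ext fun x => ?_)
  rw [← Sym2.mem_toFinset, ← Sym2.mem_toFinset, Subtype.mk.inj h]

/-- Let `τ₁, …, τₙ` be transpositions of `{0,…,n}` (multiplied left to right, i.e. the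
product is the Mathlib product of the reversed list). Their product is a full cycle on
`{0,…,n}` if and only if the `n` pairs `{aᵢ, bᵢ}` (the supports of the `τᵢ`) are
pairwise distinct and form the edge set of a tree on `{0,…,n}`. -/
theorem prod_isFullCycle_iff_graph_isTree (n : ℕ) (hn : 1 ≤ n)
    (f : Fin n → Equiv.Perm (Fin (n+1))) (hf : ∀ i, (f i).IsSwap) :
    ((((List.ofFn f).reverse).prod.IsCycle ∧
        ((List.ofFn f).reverse).prod.support = Finset.univ)) ↔
      ((Function.Injective fun i => (f i).support) ∧
        (SimpleGraph.fromRel fun a b => ∃ i, f i = Equiv.swap a b).IsTree) := by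
  have : Nontrivial (Fin (n + 1)) := Fin.nontrivial_iff_two_le.mpr (by lia)
  have hl : ∀ s ∈ (List.ofFn f).reverse, s.IsSwap := by
    simpa [List.mem_ofFn] using hf
  have hG : Equiv.Perm.swapGraph (List.ofFn f).reverse =
      SimpleGraph.fromRel fun a b => ∃ i, f i = Equiv.swap a b := by
    simp [Equiv.Perm.swapGraph, List.mem_ofFn]
  rw [Equiv.Perm.isCycle_and_support_eq_univ_iff]
  constructor
  · intro h
    have hconn : (SimpleGraph.fromRel fun a b => ∃ i, f i = Equiv.swap a b).Connected :=
      ⟨fun x y => hG ▸ Equiv.Perm.reachable_of_sameCycle_prod hl (h x y)⟩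
    have h1 := hconn.card_vert_le_card_edgeSet_add_one
    have h2 := card_edgeSet_fromRel_swap_le f
    have h3 : (univ.image fun i => (f i).support).card ≤ n := by
      simpa using card_image_le (s := univ) (f := fun i => (f i).support)
    rw [Nat.card_fin] at h1
    refine ⟨fun i j hij => ?_, ?_⟩
    · refine (card_image_iff (s := univ) (f := fun i => (f i).support)).mp ?_
        (mem_univ i) (mem_univ j) hij
      rw [card_univ, Fintype.card_fin]
      lia
    · rw [SimpleGraph.isTree_iff_connected_and_card, Nat.card_fin]
      exact ⟨hconn, by lia⟩
  · rintro ⟨hinj, htree⟩ x y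
    have hnd : (List.ofFn f).reverse.Nodup := by
      rw [List.nodup_reverse, List.nodup_ofFn]
      exact fun i j hij => hinj (congrArg Equiv.Perm.support hij)
    rw [← hG] at htree
    exact Equiv.Perm.sameCycle_prod_of_reachable hl hnd htree.isAcyclic
      (htree.connected.preconnected x y)
end

section
/- Let f = (τ_1,…,τ_n) ∈ F_n be a minimal factorization of σ_n = (0 1 ⋯ n) that contains the transposition (0 n) as a factor, say τ_k = (0 n). Then k is the unique such index; moreover τ_i fixes 0 for all i > k and τ_i fixes n for all i < k (i.e., τ_k is the rightmost factor moving 0 and the leftmost factor moving n). -/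
open Finset

/-- The smaller endpoint of a transposition (as a natural number). -/
def swapLow {m : ℕ} (τ : Equiv.Perm (Fin m)) : ℕ :=
  ((τ.support.image Fin.val).min).getD 0

/-- The larger endpoint of a transposition (as a natural number). -/
def swapHigh {m : ℕ} (τ : Equiv.Perm (Fin m)) : ℕ :=
  ((τ.support.image Fin.val).max).getD 0

/-- Minimal factorizations of the full cycle `σ_n = (0 1 ⋯ n)` into `n` transpositions.
Permutations are multiplied left to right, i.e. `τ₁τ₂⋯τₙ` sends `x` to `τₙ(⋯τ₂(τ₁(x))⋯)`,
which is the product of the reversed list in Mathlib's convention. -/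
def FactSet (n : ℕ) : Set (Fin n → Equiv.Perm (Fin (n+1))) :=
  {f | (∀ i, (f i).IsSwap) ∧ ((List.ofFn f).reverse).prod = finRotate (n+1)}

/-- The lower sequence `L(f) = (a₁, …, aₙ)` of a factorization. -/
def lowerSeq {n : ℕ} (f : Fin n → Equiv.Perm (Fin (n+1))) : Fin n → ℕ :=
  fun i => swapLow (f i)

/-- The upper sequence `U(f) = (b₁, …, bₙ)` of a factorization. -/
def upperSeq {n : ℕ} (f : Fin n → Equiv.Perm (Fin (n+1))) : Fin n → ℕ :=
  fun i => swapHigh (f i)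

/-- The lower area `area_L(f) = C(n,2) - (a₁ + ⋯ + aₙ)`. -/
def areaL {n : ℕ} (f : Fin n → Equiv.Perm (Fin (n+1))) : ℕ :=
  n.choose 2 - ∑ i, swapLow (f i)

/-- The upper area `area_U(f) = (b₁ + ⋯ + bₙ) - C(n,2)`. -/
def areaU {n : ℕ} (f : Fin n → Equiv.Perm (Fin (n+1))) : ℕ :=
  (∑ i, swapHigh (f i)) - n.choose 2

/-- A point and its image under a product of permutations are connected in any graph in which
every factor moves points within connected components. -/
lemma SimpleGraph.reachable_list_prod_apply {α : Type*} (G : SimpleGraph α)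
    (l : List (Equiv.Perm α)) (h : ∀ τ ∈ l, ∀ x, G.Reachable x (τ x)) (x : α) :
    G.Reachable x (l.prod x) := by
  induction l with
  | nil => simp
  | cons τ l ih =>
    rw [List.prod_cons, Equiv.Perm.mul_apply]
    exact (ih fun τ' hτ' => h τ' (List.mem_cons_of_mem _ hτ')).trans (h τ List.mem_cons_self _)

lemma SimpleGraph.reachable_of_sameCycle {α : Type*} [Finite α] (G : SimpleGraph α)
    {p : Equiv.Perm α} (h : ∀ x, G.Reachable x (p x)) {x y : α} (hxy : p.SameCycle x y) :
    G.Reachable x y := by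
  obtain ⟨i, rfl⟩ := hxy.exists_nat_pow_eq
  induction i with
  | zero => simp
  | succ i ih =>
    rw [pow_succ', Equiv.Perm.mul_apply]
    exact (ih ⟨i, by simp⟩).trans (h _)

/-- If a product of at most `|α| - 2` transpositions acts transitively on the complement of `a`,
then every factor fixes `a`. -/
lemma Equiv.Perm.apply_eq_of_list_prod_sameCycle {α : Type*} [Fintype α] [DecidableEq α]
    (l : List (Equiv.Perm α)) (hl : ∀ τ ∈ l, τ.IsSwap) (a : α)
    (hcycle : ∀ x y, x ≠ a → y ≠ a → l.prod.SameCycle x y)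
    (hlen : l.length + 1 < Fintype.card α) : ∀ τ ∈ l, τ a = a := by
  have hedge : ∀ τ : Equiv.Perm α, ∃ e : Sym2 α, τ.IsSwap → ∀ x, τ x ≠ x → s(x, τ x) = e := by
    intro τ
    by_cases hτ : τ.IsSwap
    · obtain ⟨u, v, -, rfl⟩ := hτ
      refine ⟨s(u, v), fun _ x hx => ?_⟩
      rcases (Equiv.swap_apply_ne_self_iff.1 hx).2 with rfl | rfl
      · simp
      · simp [Sym2.eq_swap]
    · exact ⟨s(a, a), fun h => absurd h hτ⟩
  choose φ hφ using hedge
  set E : Finset (Sym2 α) := l.toFinset.image φ with hE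
  set G : SimpleGraph α := SimpleGraph.fromEdgeSet (E : Set (Sym2 α)) with hG
  have hfactor : ∀ τ ∈ l, ∀ x, G.Reachable x (τ x) := by
    intro τ hτ x
    by_cases hx : τ x = x
    · rw [hx]
    · refine SimpleGraph.Adj.reachable ?_
      rw [hG, SimpleGraph.fromEdgeSet_adj, hφ τ (hl τ hτ) x hx]
      exact ⟨by simpa [hE] using ⟨τ, hτ, rfl⟩, Ne.symm hx⟩
  have hreach : ∀ x y, x ≠ a → y ≠ a → G.Reachable x y := fun x y hx hy =>
    G.reachable_of_sameCycle (G.reachable_list_prod_apply l hfactor) (hcycle x y hx hy)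
  intro τ hτ
  by_contra ha
  have hcenter : ∀ x, G.Reachable (τ a) x := by
    intro x
    by_cases hx : x = a
    · exact hx ▸ (hfactor τ hτ a).symm
    · exact hreach _ _ ha hx
  have hconn : G.Connected :=
    (SimpleGraph.connected_iff_exists_forall_reachable G).2 ⟨τ a, hcenter⟩
  have hcard := hconn.card_vert_le_card_edgeSet_add_one
  have hsub : G.edgeSet ⊆ (E : Set (Sym2 α)) := by
    rw [hG, SimpleGraph.edgeSet_fromEdgeSet]
    exact Set.sdiff_subset
  have hEcard : Nat.card G.edgeSet ≤ l.length := calc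
    Nat.card G.edgeSet ≤ Nat.card (E : Set (Sym2 α)) := Nat.card_mono E.finite_toSet hsub
    _ = E.card := by simp
    _ ≤ l.toFinset.card := Finset.card_image_le
    _ ≤ l.length := l.toFinset_card_le
  rw [Nat.card_eq_fintype_card] at hcard
  omega

/-- Removing the transposition `(0 n)` from the full cycle leaves a permutation that is
transitive on the nonzero points. -/
lemma finRotate_mul_swap_sameCycle (n : ℕ) (x y : Fin (n + 1)) (hx : x ≠ 0) (hy : y ≠ 0) :
    (finRotate (n + 1) * Equiv.swap 0 (Fin.last n)).SameCycle x y := by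
  set p := finRotate (n + 1) * Equiv.swap 0 (Fin.last n) with hp
  have key : ∀ i : ℕ, ∀ hi : i + 1 < n + 1,
      p.SameCycle ⟨1, by omega⟩ ⟨i + 1, hi⟩ := by
    intro i
    induction i with
    | zero => exact fun _ => Equiv.Perm.SameCycle.refl _ _
    | succ i ih =>
      intro hi
      have hstep : p ⟨i + 1, by omega⟩ = ⟨i + 1 + 1, hi⟩ := by
        rw [hp, Equiv.Perm.mul_apply, Equiv.swap_apply_of_ne_of_ne
          (by simp [Fin.ext_iff]) (by simp [Fin.ext_iff]; omega)]
        exact finRotate_of_lt (by omega)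
      rw [← hstep]
      exact Equiv.Perm.sameCycle_apply_right.2 (ih (by omega))
  have hone : ∀ z : Fin (n + 1), z ≠ 0 → ∃ i, ∃ hi : i + 1 < n + 1, z = ⟨i + 1, hi⟩ := by
    intro z hz
    have : z.val ≠ 0 := fun h => hz (Fin.ext h)
    exact ⟨z - 1, by omega, Fin.ext (by simp; omega)⟩
  obtain ⟨i, hi, rfl⟩ := hone x hx
  obtain ⟨j, hj, rfl⟩ := hone y hy
  exact (key i hi).symm.trans (key j hj)

/-- If a minimal factorization `f = (τ₁,…,τₙ)` of `σ_n` has `τ_k = (0 n)`, then `k` is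
the unique such index; moreover every later factor fixes `0` and every earlier factor
fixes `n` (i.e. `τ_k` is the rightmost factor moving `0` and the leftmost moving `n`). -/
theorem swap_zero_last_unique_and_extremal (n : ℕ)
    (f : Fin n → Equiv.Perm (Fin (n+1))) (hf : f ∈ FactSet n)
    (k : Fin n) (hk : f k = Equiv.swap 0 (Fin.last n)) :
    (∀ k', f k' = Equiv.swap 0 (Fin.last n) → k' = k) ∧
    (∀ i, k < i → f i 0 = 0) ∧
    (∀ i, i < k → f i (Fin.last n) = Fin.last n) := by
  obtain ⟨hswap, hprod⟩ := hf
  set t : Equiv.Perm (Fin (n + 1)) := Equiv.swap 0 (Fin.last n) with ht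
  have htt : t * t = 1 := Equiv.swap_mul_self _ _
  set A := (List.ofFn f).take k with hA
  set B := (List.ofFn f).drop (k + 1) with hB
  have hsplit : List.ofFn f = A ++ t :: B := by
    have hget : (List.ofFn f)[(k : ℕ)]'(by simp) = t := by simp [hk]
    rw [hA, hB, ← hget, List.cons_getElem_drop_succ, List.take_append_drop]
  have hmem : ∀ τ ∈ List.ofFn f, τ.IsSwap := by
    intro τ hτ
    obtain ⟨i, rfl⟩ := (List.mem_ofFn' f τ).1 hτ
    exact hswap i
  set l := B.reverse ++ A.reverse.map (MulAut.conj t) with hl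
  have hlprod : l.prod = finRotate (n + 1) * t := by
    rw [← hprod, hsplit, hl, List.prod_append, ← map_list_prod, MulAut.conj_apply,
      inv_eq_of_mul_eq_one_left htt]
    simp [mul_assoc]
  have hlswap : ∀ τ ∈ l, τ.IsSwap := by
    intro τ hτ
    rw [hl, List.mem_append, List.mem_reverse, List.mem_map] at hτ
    rcases hτ with hτ | ⟨τ, hτ, rfl⟩
    · exact hmem τ (List.mem_of_mem_drop hτ)
    · obtain ⟨u, v, huv, rfl⟩ := hmem τ (List.mem_of_mem_take (List.mem_reverse.1 hτ))
      refine ⟨t u, t v, t.injective.ne huv, ?_⟩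
      rw [MulAut.conj_apply, Equiv.swap_apply_apply]
  have hlen : l.length + 1 < Fintype.card (Fin (n + 1)) := by
    have h := congrArg List.length hsplit
    simp only [List.length_ofFn, List.length_append, List.length_cons] at h
    simp only [hl, List.length_append, List.length_reverse, List.length_map, Fintype.card_fin]
    omega
  have hfix : ∀ τ ∈ l, τ 0 = 0 :=
    Equiv.Perm.apply_eq_of_list_prod_sameCycle l hlswap 0
      (fun x y hx hy => hlprod ▸ finRotate_mul_swap_sameCycle n x y hx hy) hlen
  have hlater : ∀ i, k < i → f i 0 = 0 := by
    intro i hi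
    refine hfix _ (List.mem_append_left _ (List.mem_reverse.2 (List.mem_drop_iff_getElem.2 ?_)))
    have hi' : (k : ℕ) < i := hi
    refine ⟨i - (k + 1), by simp; omega, ?_⟩
    simp only [List.getElem_ofFn]
    congr 1
    exact Fin.ext (by simp; omega)
  have hearlier : ∀ i, i < k → f i (Fin.last n) = Fin.last n := by
    intro i hi
    have hiA : f i ∈ A := List.mem_take_iff_getElem.2 ⟨i, by simpa using hi, by simp⟩
    have h := hfix (MulAut.conj t (f i))
      (List.mem_append_right _ (List.mem_map_of_mem (List.mem_reverse.2 hiA)))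
    rw [MulAut.conj_apply, inv_eq_of_mul_eq_one_left htt, Equiv.Perm.mul_apply,
      Equiv.Perm.mul_apply, ht, Equiv.swap_apply_left] at h
    exact (Equiv.swap 0 (Fin.last n)).injective (h.trans (Equiv.swap_apply_right _ _).symm)
  refine ⟨fun k' hk' => ?_, hlater, hearlier⟩
  have hlast : Fin.last n ≠ 0 := fun h => by
    have := congrArg Fin.val h
    have := k.isLt
    simp at *
    omega
  rcases lt_trichotomy k' k with h | h | h
  · have := hearlier k' h
    rw [hk', Equiv.swap_apply_right] at this
    exact absurd this.symm hlast
  · exact h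
  · have := hlater k' h
    rw [hk', Equiv.swap_apply_left] at this
    exact absurd this hlast
end

section
/- For n ≥ 1, the bivariate area enumerator of simple minimal factorizations satisfies Ĥ_n(q,t) = t · (t^{n−1} + t^{n−2}q + ⋯ + q^{n−1}) · F_{n−1}(q,t), where Ĥ_n(q,t) = ∑_{f ∈ Ĥ_n} q^{area_L(f)} t^{area_U(f)} is the sum over simple factorizations f ∈ F_n. -/
open Finset MvPolynomial

attribute [local instance] Classical.propDecidable

/-- The bivariate area enumerator
`F_n(q,t) = ∑_{f ∈ F_n} q^{area_L f} t^{area_U f}`, an element of `ℤ[q,t]`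
with `q = X 0` and `t = X 1`. -/
noncomputable def Fpoly (n : ℕ) : MvPolynomial (Fin 2) ℤ :=
  ∑ f : {f : Fin n → Equiv.Perm (Fin (n+1)) // f ∈ FactSet n},
    MvPolynomial.X 0 ^ areaL f.1 * MvPolynomial.X 1 ^ areaU f.1

/-- The bivariate area enumerator of simple minimal factorizations (those containing the
factor `(0 n)`). -/
noncomputable def Hpoly (n : ℕ) : MvPolynomial (Fin 2) ℤ :=
  ∑ f : {f : Fin n → Equiv.Perm (Fin (n+1)) //
      f ∈ FactSet n ∧ ∃ k, f k = Equiv.swap 0 (Fin.last n)},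
    X 0 ^ areaL f.1 * X 1 ^ areaU f.1


open Equiv

/-- If the transpositions in `l` act transitively, then each point other than a given root can be
matched, injectively, with a transposition moving it. -/
theorem exists_injective_moving {α : Type*} [DecidableEq α] (l : List (Perm α))
    (hl : ∀ τ ∈ l, τ.IsSwap) (r : α)
    (h : ∀ S : Set α, r ∈ S → (∀ τ ∈ l, ∀ x ∈ S, τ x ∈ S) → ∀ v, v ∈ S) :
    ∃ φ : {v // v ≠ r} → Fin l.length, Function.Injective φ ∧ ∀ v, l[φ v] v.1 ≠ v.1 := by
  have hswap : ∀ τ ∈ l, ∀ u v, τ u ≠ u → τ v ≠ v → u ≠ v → τ u = v := by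
    intro τ hτ u v hu hv huv
    obtain ⟨a, b, hab, rfl⟩ := hl τ hτ
    grind [swap_apply_ne_self_iff, swap_apply_left, swap_apply_right]
  have hinv : ∀ τ ∈ l, ∀ u, τ (τ u) = u := by
    intro τ hτ u
    obtain ⟨a, b, hab, rfl⟩ := hl τ hτ
    simp
  let G : SimpleGraph α :=
    { Adj := fun u v => u ≠ v ∧ ∃ τ ∈ l, τ u = v
      symm := ⟨by
        rintro u v ⟨huv, τ, hτ, rfl⟩
        exact ⟨huv.symm, τ, hτ, hinv τ hτ u⟩⟩
      loopless := ⟨fun u hu => hu.1 rfl⟩ }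
  have hreach : ∀ v, G.Reachable v r := by
    refine h {v | G.Reachable v r} (SimpleGraph.Reachable.refl r) ?_
    intro τ hτ x hx
    by_cases hxx : τ x = x
    · rwa [hxx]
    · have : G.Adj (τ x) x := ⟨hxx, τ, hτ, hinv τ hτ x⟩
      exact this.reachable.trans hx
  have hstep : ∀ v : {v // v ≠ r}, ∃ i : Fin l.length,
      l[i] v.1 ≠ v.1 ∧ G.dist (l[i] v.1) r < G.dist v.1 r := by
    rintro ⟨v, hv⟩
    obtain ⟨p, hp⟩ := (hreach v).exists_walk_length_eq_dist
    cases p with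
    | nil => exact absurd rfl hv
    | cons hadj p =>
      obtain ⟨huv, τ, hτ, rfl⟩ := hadj
      obtain ⟨i, hi, rfl⟩ := List.getElem_of_mem hτ
      refine ⟨⟨i, hi⟩, huv.symm, ?_⟩
      have := SimpleGraph.dist_le p
      simp only [SimpleGraph.Walk.length_cons] at hp
      simp only [Fin.getElem_fin]
      omega
  choose φ hφ hd using hstep
  refine ⟨φ, ?_, hφ⟩
  intro v w hvw
  by_contra hne
  have hne' : v.1 ≠ w.1 := fun e => hne (Subtype.ext e)
  have hw := hφ w
  have hdv := hd v
  have hdw := hd w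
  rw [← hvw] at hw hdw
  have hmem : l[φ v] ∈ l := List.getElem_mem _
  rw [hswap _ hmem _ _ (hφ v) hw hne'] at hdv
  rw [hswap _ hmem _ _ hw (hφ v) hne'.symm] at hdw
  omega

theorem prod_apply_mem {α : Type*} (S : Set α) (l : List (Perm α))
    (h : ∀ τ ∈ l, ∀ x ∈ S, τ x ∈ S) : ∀ x ∈ S, l.prod x ∈ S := by
  induction l with
  | nil => simp
  | cons τ l ih =>
    intro x hx
    rw [List.prod_cons, Perm.mul_apply]
    exact h τ (by simp) _ (ih (fun τ' h' => h τ' (by simp [h'])) x hx)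

theorem reverse_prod_apply_mem {α : Type*} (S : Set α) (l : List (Perm α))
    (h : ∀ τ ∈ l, ∀ x ∈ S, τ x ∈ S) : ∀ x ∈ S, l.reverse.prod x ∈ S :=
  prod_apply_mem S l.reverse fun τ hτ => h τ (List.mem_reverse.1 hτ)

theorem mem_of_finRotate_closed {m : ℕ} (S : Set (Fin (m + 1)))
    (h : ∀ x ∈ S, finRotate (m + 1) x ∈ S) {r : Fin (m + 1)} (hr : r ∈ S) (v : Fin (m + 1)) :
    v ∈ S := by
  have key : ∀ k : ℕ, r + Fin.ofNat (m + 1) k ∈ S := by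
    intro k
    induction k with
    | zero => simpa using hr
    | succ k ih =>
      have := h _ ih
      rw [finRotate_apply, add_assoc] at this
      convert this using 2
      ext
      simp [Fin.val_add]
  have := key (v - r).val
  simpa using this

/-- The embedding of permutations of `Fin (m+1)` that fixes the last point of `Fin (m+2)`. -/
noncomputable def permCastSucc (m : ℕ) : Perm (Fin (m + 1)) →* Perm (Fin (m + 2)) :=
  Perm.viaEmbeddingHom Fin.castSuccEmb

/-- The embedding of permutations of `Fin (m+1)` that fixes `0` in `Fin (m+2)`. -/
noncomputable def permSucc (m : ℕ) : Perm (Fin (m + 1)) →* Perm (Fin (m + 2)) :=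
  Perm.viaEmbeddingHom (Fin.succEmb (m + 1))

theorem permCastSucc_castSucc {m : ℕ} (π : Perm (Fin (m + 1))) (x : Fin (m + 1)) :
    permCastSucc m π x.castSucc = (π x).castSucc :=
  Perm.viaEmbedding_apply π Fin.castSuccEmb x

theorem permCastSucc_last {m : ℕ} (π : Perm (Fin (m + 1))) :
    permCastSucc m π (Fin.last (m + 1)) = Fin.last (m + 1) :=
  Perm.viaEmbedding_apply_of_notMem π _ _ (by simp)

theorem permSucc_succ {m : ℕ} (π : Perm (Fin (m + 1))) (x : Fin (m + 1)) :
    permSucc m π x.succ = (π x).succ :=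
  Perm.viaEmbedding_apply π (Fin.succEmb (m + 1)) x

theorem permSucc_zero {m : ℕ} (π : Perm (Fin (m + 1))) : permSucc m π 0 = 0 :=
  Perm.viaEmbedding_apply_of_notMem π _ _ (by simp)

theorem permCastSucc_injective (m : ℕ) : Function.Injective (permCastSucc m) :=
  Perm.viaEmbeddingHom_injective _

theorem permSucc_injective (m : ℕ) : Function.Injective (permSucc m) :=
  Perm.viaEmbeddingHom_injective _

theorem permCastSucc_swap {m : ℕ} (a b : Fin (m + 1)) :
    permCastSucc m (swap a b) = swap a.castSucc b.castSucc := by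
  ext x
  induction x using Fin.lastCases with
  | last =>
    rw [permCastSucc_last, swap_apply_of_ne_of_ne (Fin.castSucc_ne_last _).symm
      (Fin.castSucc_ne_last _).symm]
  | cast x =>
    rw [permCastSucc_castSucc, (Fin.castSucc_injective _).swap_apply]

theorem permSucc_swap {m : ℕ} (a b : Fin (m + 1)) :
    permSucc m (swap a b) = swap a.succ b.succ := by
  ext x
  induction x using Fin.cases with
  | zero =>
    rw [permSucc_zero, swap_apply_of_ne_of_ne (Fin.succ_ne_zero _).symm
      (Fin.succ_ne_zero _).symm]
  | succ x =>
    rw [permSucc_succ, (Fin.succ_injective _).swap_apply]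

theorem finRotate_castSucc {m : ℕ} (x : Fin (m + 1)) : finRotate (m + 2) x.castSucc = x.succ := by
  rw [finRotate_apply, Fin.coeSucc_eq_succ]

/-- Shifting by one is conjugation by the full cycle. -/
theorem permSucc_eq_conj {m : ℕ} (π : Perm (Fin (m + 1))) :
    permSucc m π = finRotate (m + 2) * permCastSucc m π * (finRotate (m + 2))⁻¹ := by
  rw [eq_mul_inv_iff_mul_eq]
  ext x
  induction x using Fin.lastCases with
  | last => simp [permCastSucc_last, permSucc_zero]
  | cast x =>
    simp [Perm.mul_apply, permCastSucc_castSucc, permSucc_succ, finRotate_castSucc,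
      -finRotate_apply]

theorem permCastSucc_finRotate (m : ℕ) :
    permCastSucc m (finRotate (m + 1)) = swap 0 (Fin.last (m + 1)) * finRotate (m + 2) := by
  ext x
  induction x using Fin.lastCases with
  | last => simp [permCastSucc_last]
  | cast x =>
    rw [permCastSucc_castSucc, Perm.mul_apply, finRotate_castSucc]
    induction x using Fin.lastCases with
    | last => simp
    | cast y =>
      rw [swap_apply_of_ne_of_ne (Fin.succ_ne_zero _)]
      · obtain _ | m := m
        · exact y.elim0
        · rw [finRotate_castSucc]; simp
      · simp [Fin.ext_iff]; omega

theorem isSwap_permCastSucc {m : ℕ} {τ : Perm (Fin (m + 1))} (h : τ.IsSwap) :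
    (permCastSucc m τ).IsSwap := by
  obtain ⟨a, b, hab, rfl⟩ := h
  exact ⟨_, _, fun e => hab (Fin.castSucc_injective _ e), permCastSucc_swap a b⟩

theorem isSwap_permSucc {m : ℕ} {τ : Perm (Fin (m + 1))} (h : τ.IsSwap) :
    (permSucc m τ).IsSwap := by
  obtain ⟨a, b, hab, rfl⟩ := h
  exact ⟨_, _, fun e => hab (Fin.succ_injective _ e), permSucc_swap a b⟩

/-- A transposition fixing the last point comes from a transposition of the other points. -/
theorem exists_permCastSucc_eq {m : ℕ} {τ : Perm (Fin (m + 2))} (h : τ.IsSwap)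
    (hlast : τ (Fin.last (m + 1)) = Fin.last (m + 1)) :
    ∃ τ' : Perm (Fin (m + 1)), τ'.IsSwap ∧ permCastSucc m τ' = τ := by
  obtain ⟨a, b, hab, rfl⟩ := h
  induction a using Fin.lastCases with
  | last => exact absurd ((swap_apply_left _ _).symm.trans hlast) hab.symm
  | cast a =>
    induction b using Fin.lastCases with
    | last => exact absurd ((swap_apply_right _ _).symm.trans hlast) hab
    | cast b =>
      exact ⟨swap a b, ⟨a, b, fun e => hab (by rw [e]), rfl⟩, permCastSucc_swap a b⟩

/-- If `m` transpositions of `m+2` points multiply to a cycle on the first `m+1` points, then each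
of them fixes the last point. -/
theorem fixes_last_of_reverse_prod {m : ℕ} (l : List (Perm (Fin (m + 2)))) (hlen : l.length = m)
    (hl : ∀ τ ∈ l, τ.IsSwap) (hprod : l.reverse.prod = permCastSucc m (finRotate (m + 1))) :
    ∀ τ ∈ l, τ (Fin.last (m + 1)) = Fin.last (m + 1) := by
  intro τ hτ
  by_contra hne
  obtain ⟨φ, hφ, -⟩ := exists_injective_moving l hl (Fin.last (m + 1)) (by
    intro S hr hS v
    induction v using Fin.lastCases with
    | last => exact hr
    | cast v =>
      obtain ⟨j, hj⟩ := Fin.exists_castSucc_eq.2 hne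
      refine mem_of_finRotate_closed (Fin.castSucc ⁻¹' S) ?_ (r := j) ?_ v
      · intro x hx
        have := reverse_prod_apply_mem S l hS _ hx
        rwa [hprod, permCastSucc_castSucc] at this
      · change j.castSucc ∈ S
        rw [hj]
        exact hS τ hτ _ hr)
  have := Fintype.card_le_of_injective φ hφ
  simp [hlen] at this

theorem swapLow_swap {m : ℕ} {a b : Fin m} (h : a < b) : swapLow (swap a b) = a := by
  have : ((swap a b).support.image Fin.val).min = ((a : ℕ) : WithTop ℕ) := by
    rw [Perm.support_swap h.ne]
    simp [h.le]
  simp only [swapLow, this]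
  rfl

theorem swapHigh_swap {m : ℕ} {a b : Fin m} (h : a < b) : swapHigh (swap a b) = b := by
  have : ((swap a b).support.image Fin.val).max = ((b : ℕ) : WithBot ℕ) := by
    rw [Perm.support_swap h.ne]
    simp [h.le]
    rfl
  simp only [swapHigh, this]
  rfl

theorem exists_lt_of_isSwap {m : ℕ} {τ : Perm (Fin m)} (h : τ.IsSwap) :
    ∃ a b, a < b ∧ τ = swap a b := by
  obtain ⟨a, b, hab, rfl⟩ := h
  rcases lt_or_gt_of_ne hab with h | h
  · exact ⟨a, b, h, rfl⟩
  · exact ⟨b, a, h, swap_comm a b⟩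

theorem swapLow_le_of_moves {m : ℕ} {τ : Perm (Fin m)} (h : τ.IsSwap) {v : Fin m} (hv : τ v ≠ v) :
    swapLow τ ≤ v := by
  obtain ⟨a, b, hab, rfl⟩ := exists_lt_of_isSwap h
  rw [swapLow_swap hab]
  rcases (swap_apply_ne_self_iff.1 hv).2 with rfl | rfl
  · exact le_rfl
  · exact hab.le

theorem le_swapHigh_of_moves {m : ℕ} {τ : Perm (Fin m)} (h : τ.IsSwap) {v : Fin m}
    (hv : τ v ≠ v) : v ≤ swapHigh τ := by
  obtain ⟨a, b, hab, rfl⟩ := exists_lt_of_isSwap h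
  rw [swapHigh_swap hab]
  rcases (swap_apply_ne_self_iff.1 hv).2 with rfl | rfl
  · exact hab.le
  · exact le_rfl

theorem swapLow_permCastSucc {m : ℕ} {τ : Perm (Fin (m + 1))} (h : τ.IsSwap) :
    swapLow (permCastSucc m τ) = swapLow τ := by
  obtain ⟨a, b, hab, rfl⟩ := exists_lt_of_isSwap h
  rw [permCastSucc_swap, swapLow_swap hab, swapLow_swap (Fin.castSucc_lt_castSucc_iff.2 hab)]
  rfl

theorem swapHigh_permCastSucc {m : ℕ} {τ : Perm (Fin (m + 1))} (h : τ.IsSwap) :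
    swapHigh (permCastSucc m τ) = swapHigh τ := by
  obtain ⟨a, b, hab, rfl⟩ := exists_lt_of_isSwap h
  rw [permCastSucc_swap, swapHigh_swap hab, swapHigh_swap (Fin.castSucc_lt_castSucc_iff.2 hab)]
  rfl

theorem swapLow_permSucc {m : ℕ} {τ : Perm (Fin (m + 1))} (h : τ.IsSwap) :
    swapLow (permSucc m τ) = swapLow τ + 1 := by
  obtain ⟨a, b, hab, rfl⟩ := exists_lt_of_isSwap h
  rw [permSucc_swap, swapLow_swap hab, swapLow_swap (Fin.succ_lt_succ_iff.2 hab)]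
  rfl

theorem swapHigh_permSucc {m : ℕ} {τ : Perm (Fin (m + 1))} (h : τ.IsSwap) :
    swapHigh (permSucc m τ) = swapHigh τ + 1 := by
  obtain ⟨a, b, hab, rfl⟩ := exists_lt_of_isSwap h
  rw [permSucc_swap, swapHigh_swap hab, swapHigh_swap (Fin.succ_lt_succ_iff.2 hab)]
  rfl

/-- In a minimal factorization, the points other than a given root correspond bijectively to
factors moving them. -/
theorem exists_bijective_moving {m : ℕ} {f : Fin m → Perm (Fin (m + 1))} (hf : f ∈ FactSet m)
    (r : Fin (m + 1)) :
    ∃ φ : {v // v ≠ r} → Fin m, Function.Bijective φ ∧ ∀ v, f (φ v) v.1 ≠ v.1 := by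
  obtain ⟨φ, hφ, hmove⟩ := exists_injective_moving (List.ofFn f)
    (by simpa [List.mem_ofFn] using hf.1) r (by
      intro S hr hS v
      refine mem_of_finRotate_closed S (fun x hx => ?_) hr v
      rw [← hf.2]
      exact reverse_prod_apply_mem S _ hS x hx)
  refine ⟨fun v => Fin.cast List.length_ofFn (φ v), ?_, ?_⟩
  · rw [Fintype.bijective_iff_injective_and_card]
    refine ⟨(Fin.cast_injective _).comp hφ, ?_⟩
    simp
  · intro v
    have := hmove v
    rwa [Fin.getElem_fin, List.getElem_ofFn] at this

theorem sum_val_eq (m : ℕ) : ∑ v : Fin (m + 1), v.val = m.choose 2 + m := by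
  rw [Fin.sum_univ_eq_sum_range (fun i => i), Finset.sum_range_id, ← Nat.choose_two_right,
    Nat.choose_succ_succ' m 1, Nat.choose_one_right, add_comm]

theorem sum_swapLow_le {m : ℕ} {f : Fin m → Perm (Fin (m + 1))} (hf : f ∈ FactSet m) :
    ∑ i, swapLow (f i) ≤ m.choose 2 := by
  obtain ⟨φ, hφ, hmove⟩ := exists_bijective_moving hf (Fin.last m)
  calc ∑ i, swapLow (f i) = ∑ v, swapLow (f (φ v)) := (hφ.sum_comp fun i => swapLow (f i)).symm
    _ ≤ ∑ v : {v // v ≠ Fin.last m}, v.1.val :=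
      Finset.sum_le_sum fun v _ => swapLow_le_of_moves (hf.1 _) (hmove v)
    _ = m.choose 2 := by
      have h := Fintype.sum_eq_add_sum_subtype_ne (fun v : Fin (m + 1) => v.val) (Fin.last m)
      rw [sum_val_eq] at h
      simp only [Fin.val_last] at h
      omega

theorem choose_le_sum_swapHigh {m : ℕ} {f : Fin m → Perm (Fin (m + 1))} (hf : f ∈ FactSet m) :
    m.choose 2 ≤ ∑ i, swapHigh (f i) := by
  obtain ⟨φ, hφ, hmove⟩ := exists_bijective_moving hf 0
  calc m.choose 2 ≤ ∑ v : {v : Fin (m + 1) // v ≠ 0}, v.1.val := by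
        have h := Fintype.sum_eq_add_sum_subtype_ne (fun v : Fin (m + 1) => v.val) 0
        rw [sum_val_eq] at h
        simp only [Fin.val_zero] at h
        omega
    _ ≤ ∑ v, swapHigh (f (φ v)) :=
      Finset.sum_le_sum fun v _ => le_swapHigh_of_moves (hf.1 _) (hmove v)
    _ = ∑ i, swapHigh (f i) := hφ.sum_comp fun i => swapHigh (f i)

/-- The simple factorization obtained from the list of factors of a factorization by moving its
first `k` factors, shifted by one, to the end, and putting `(0 n)` before them. -/
noncomputable def simpleList {m : ℕ} (l : List (Perm (Fin (m + 1)))) (k : ℕ) :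
    List (Perm (Fin (m + 2))) :=
  (l.drop k).map (permCastSucc m) ++
    swap 0 (Fin.last (m + 1)) :: (l.take k).map (permSucc m)

theorem length_simpleList {m : ℕ} {l : List (Perm (Fin (m + 1)))} (hl : l.length = m) (k : ℕ) :
    (simpleList l k).length = m + 1 := by
  simp [simpleList, hl]
  omega

theorem isSwap_of_mem_simpleList {m : ℕ} {l : List (Perm (Fin (m + 1)))}
    (hl : ∀ τ ∈ l, τ.IsSwap) (k : ℕ) : ∀ τ ∈ simpleList l k, τ.IsSwap := by
  intro τ hτ
  simp only [simpleList, List.mem_append, List.mem_map, List.mem_cons] at hτ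
  obtain ⟨τ, h, rfl⟩ | rfl | ⟨τ, h, rfl⟩ := hτ
  · exact isSwap_permCastSucc (hl τ (List.mem_of_mem_drop h))
  · exact ⟨_, _, (Fin.last_pos).ne, rfl⟩
  · exact isSwap_permSucc (hl τ (List.mem_of_mem_take h))

theorem reverse_prod_simpleList {m : ℕ} {l : List (Perm (Fin (m + 1)))}
    (hl : l.reverse.prod = finRotate (m + 1)) (k : ℕ) :
    (simpleList l k).reverse.prod = finRotate (m + 2) := by
  have h := permCastSucc_finRotate m
  rw [← hl, ← List.take_append_drop k l, List.reverse_append, List.prod_append, map_mul,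
    ← eq_mul_inv_iff_mul_eq] at h
  simp only [simpleList, List.reverse_append, List.reverse_cons, List.prod_append,
    ← List.map_reverse, List.prod_hom, List.prod_singleton, permSucc_eq_conj, h]
  have hs : swap 0 (Fin.last (m + 1)) * swap 0 (Fin.last (m + 1)) = 1 := swap_mul_self _ _
  simp [mul_assoc, ← mul_assoc (swap 0 (Fin.last (m + 1))) (swap 0 (Fin.last (m + 1)))]

theorem permCastSucc_ne_swap {m : ℕ} (π : Perm (Fin (m + 1))) :
    permCastSucc m π ≠ swap 0 (Fin.last (m + 1)) := by
  intro h
  have := permCastSucc_last π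
  rw [h, swap_apply_right] at this
  exact Fin.last_pos.ne this

theorem permSucc_ne_swap {m : ℕ} (π : Perm (Fin (m + 1))) :
    permSucc m π ≠ swap 0 (Fin.last (m + 1)) := by
  intro h
  have := permSucc_zero π
  rw [h, swap_apply_left] at this
  exact Fin.last_pos.ne' this

theorem simpleList_inj {m : ℕ} {l l' : List (Perm (Fin (m + 1)))} {k k' : ℕ} (hk : k ≤ l.length)
    (hk' : k' ≤ l'.length) (h : simpleList l k = simpleList l' k') : l = l' ∧ k = k' := by
  rw [simpleList, simpleList, List.append_cons_inj_of_notMem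
    
    (by simp [permCastSucc_ne_swap, -List.map_drop])
    (by simp [permSucc_ne_swap, -List.map_take])] at h
  obtain ⟨hd, -, ht⟩ := h
  have hd := List.map_injective_iff.2 (permCastSucc_injective m) hd
  have ht := List.map_injective_iff.2 (permSucc_injective m) ht
  refine ⟨by rw [← List.take_append_drop k l, hd, ht, List.take_append_drop], ?_⟩
  simpa [hk, hk'] using congrArg List.length ht

theorem exists_simpleList_eq {m : ℕ} {g : List (Perm (Fin (m + 2)))} (hlen : g.length = m + 1)
    (hg : ∀ τ ∈ g, τ.IsSwap) (hprod : g.reverse.prod = finRotate (m + 2))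
    (hmem : swap 0 (Fin.last (m + 1)) ∈ g) :
    ∃ (l : List (Perm (Fin (m + 1)))) (k : ℕ), l.length = m ∧ k ≤ m ∧ (∀ τ ∈ l, τ.IsSwap) ∧
      l.reverse.prod = finRotate (m + 1) ∧ simpleList l k = g := by
  obtain ⟨l₁, l₂, rfl⟩ := List.append_of_mem hmem
  set c := finRotate (m + 2) with hc
  let conj : Perm (Fin (m + 2)) →* Perm (Fin (m + 2)) := (MulAut.conj c⁻¹).toMonoidHom
  have hconj : ∀ τ, conj τ = c⁻¹ * τ * c := fun τ => by simp [conj]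
  have hswap : ∀ τ ∈ l₂.map conj ++ l₁, τ.IsSwap := by
    intro τ hτ
    rw [List.mem_append, List.mem_map] at hτ
    obtain ⟨τ, h, rfl⟩ | h := hτ
    · obtain ⟨a, b, hab, rfl⟩ := hg τ (by simp [h])
      refine ⟨c⁻¹ a, c⁻¹ b, fun e => hab (c⁻¹.injective e), ?_⟩
      rw [hconj, mul_swap_eq_swap_mul, inv_mul_cancel_right]
    · exact hg τ (by simp [h])
  have hprod' : (l₂.map conj ++ l₁).reverse.prod = permCastSucc m (finRotate (m + 1)) := by
    rw [permCastSucc_finRotate, List.reverse_append, List.prod_append, ← List.map_reverse,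
      List.prod_hom, hconj]
    simp only [List.reverse_append, List.reverse_cons, List.prod_append,
      List.prod_singleton] at hprod
    rw [mul_assoc, ← eq_mul_inv_iff_mul_eq] at hprod
    rw [hprod, ← hc]
    simp [mul_assoc]
  have hlen' : (l₂.map conj ++ l₁).length = m := by
    simp at hlen ⊢
    omega
  have hfix := fixes_last_of_reverse_prod _ hlen' hswap hprod'
  have hlift : ∃ l : List (Perm (Fin (m + 1))), (∀ τ ∈ l, τ.IsSwap) ∧
      l.map (permCastSucc m) = l₂.map conj ++ l₁ := by
    generalize l₂.map conj ++ l₁ = L at hswap hfix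
    clear hlen' hprod'
    induction L with
    | nil => exact ⟨[], by simp, rfl⟩
    | cons τ L ih =>
      obtain ⟨l, hl, rfl⟩ := ih (fun τ h => hswap τ (by simp [h])) (fun τ h => hfix τ (by simp [h]))
      obtain ⟨τ, h, rfl⟩ := exists_permCastSucc_eq (hswap τ (by simp)) (hfix τ (by simp))
      exact ⟨τ :: l, by simpa using ⟨h, hl⟩, rfl⟩
  obtain ⟨l, hl, hmap⟩ := hlift
  refine ⟨l, l₂.length, ?_, ?_, hl, ?_, ?_⟩
  · rw [← hmap, List.length_map] at hlen'
    exact hlen'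
  · simp at hlen'
    omega
  · apply permCastSucc_injective m
    rw [← hprod', ← hmap, ← List.map_reverse, List.prod_hom]
  · have hd : (l.drop l₂.length).map (permCastSucc m) = l₁ := by
      rw [List.map_drop, hmap, List.drop_left' (by simp)]
    have ht : (l.take l₂.length).map (permCastSucc m) = l₂.map conj := by
      rw [List.map_take, hmap, List.take_left' (by simp)]
    have ht' : (l.take l₂.length).map (permSucc m) = l₂ := by
      have := congrArg (List.map fun τ => c * τ * c⁻¹) ht
      simp only [List.map_map] at this
      convert this using 2
      · ext1 τ
        exact permSucc_eq_conj τ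
      · symm
        convert List.map_id l₂
        ext1 τ
        simp [hconj, mul_assoc]
    rw [simpleList, hd, ht']

theorem sum_map_add_one {α : Type*} {l : List α} {g h : α → ℕ} (H : ∀ x ∈ l, g x = h x + 1) :
    (l.map g).sum = (l.map h).sum + l.length := by
  rw [List.map_congr_left H, List.sum_map_add]
  simp

theorem sum_swapLow_simpleList {m : ℕ} {l : List (Perm (Fin (m + 1)))} (hl : ∀ τ ∈ l, τ.IsSwap)
    {k : ℕ} (hk : k ≤ l.length) :
    ((simpleList l k).map swapLow).sum = (l.map swapLow).sum + k := by
  have hd : (l.drop k).map (swapLow ∘ permCastSucc m) = (l.drop k).map swapLow :=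
    List.map_congr_left fun τ h => swapLow_permCastSucc (hl τ (List.mem_of_mem_drop h))
  have ht := sum_map_add_one (l := l.take k) (g := swapLow ∘ permSucc m) (h := swapLow)
    fun τ h => swapLow_permSucc (hl τ (List.mem_of_mem_take h))
  have hsum : (l.map swapLow).sum =
      ((l.take k).map swapLow).sum + ((l.drop k).map swapLow).sum := by
    rw [← List.sum_append, ← List.map_append, List.take_append_drop]
  have h0 : swapLow (swap 0 (Fin.last (m + 1))) = 0 := swapLow_swap Fin.last_pos
  rw [List.length_take_of_le hk] at ht
  rw [simpleList, List.map_append, List.map_cons, List.sum_append, List.sum_cons, List.map_map,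
    List.map_map, hd, ht, h0, hsum]
  ring

theorem sum_swapHigh_simpleList {m : ℕ} {l : List (Perm (Fin (m + 1)))} (hl : ∀ τ ∈ l, τ.IsSwap)
    {k : ℕ} (hk : k ≤ l.length) :
    ((simpleList l k).map swapHigh).sum = (l.map swapHigh).sum + k + (m + 1) := by
  have hd : (l.drop k).map (swapHigh ∘ permCastSucc m) = (l.drop k).map swapHigh :=
    List.map_congr_left fun τ h => swapHigh_permCastSucc (hl τ (List.mem_of_mem_drop h))
  have ht := sum_map_add_one (l := l.take k) (g := swapHigh ∘ permSucc m) (h := swapHigh)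
    fun τ h => swapHigh_permSucc (hl τ (List.mem_of_mem_take h))
  have hsum : (l.map swapHigh).sum =
      ((l.take k).map swapHigh).sum + ((l.drop k).map swapHigh).sum := by
    rw [← List.sum_append, ← List.map_append, List.take_append_drop]
  have h0 : swapHigh (swap 0 (Fin.last (m + 1))) = m + 1 := swapHigh_swap Fin.last_pos
  rw [List.length_take_of_le hk] at ht
  rw [simpleList, List.map_append, List.map_cons, List.sum_append, List.sum_cons, List.map_map,
    List.map_map, hd, ht, h0, hsum]
  ring

/-- `simpleList` on factorizations given as functions. -/
noncomputable def simpleFact {m : ℕ} (f : Fin m → Perm (Fin (m + 1))) (k : ℕ) :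
    Fin (m + 1) → Perm (Fin (m + 2)) :=
  fun i => (simpleList (List.ofFn f) k)[i.val]'(by
    rw [length_simpleList List.length_ofFn]; exact i.isLt)

theorem ofFn_simpleFact {m : ℕ} (f : Fin m → Perm (Fin (m + 1))) (k : ℕ) :
    List.ofFn (simpleFact f k) = simpleList (List.ofFn f) k := by
  apply List.ext_getElem
  · rw [List.length_ofFn, length_simpleList List.length_ofFn]
  · intro i h₁ h₂
    rw [List.getElem_ofFn]
    rfl

theorem isSwap_of_mem_ofFn {m : ℕ} {f : Fin m → Perm (Fin (m + 1))} (hf : f ∈ FactSet m) :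
    ∀ τ ∈ List.ofFn f, τ.IsSwap := by
  simpa [List.mem_ofFn] using hf.1

theorem simpleFact_mem {m : ℕ} {f : Fin m → Perm (Fin (m + 1))} (hf : f ∈ FactSet m) (k : ℕ) :
    simpleFact f k ∈ FactSet (m + 1) ∧ ∃ i, simpleFact f k i = swap 0 (Fin.last (m + 1)) := by
  refine ⟨⟨fun i => ?_, ?_⟩, ?_⟩
  · exact isSwap_of_mem_simpleList (isSwap_of_mem_ofFn hf) k _ (List.getElem_mem _)
  · rw [ofFn_simpleFact]
    exact reverse_prod_simpleList hf.2 k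
  · rw [← Set.mem_range, ← List.mem_ofFn', ofFn_simpleFact]
    simp [simpleList]

theorem areaL_simpleFact {m : ℕ} {f : Fin m → Perm (Fin (m + 1))} (hf : f ∈ FactSet m) {k : ℕ}
    (hk : k ≤ m) : areaL (simpleFact f k) = areaL f + (m - k) := by
  have h := sum_swapLow_simpleList (isSwap_of_mem_ofFn hf) (k := k) (by simpa using hk)
  rw [← ofFn_simpleFact, List.map_ofFn, List.map_ofFn, List.sum_ofFn, List.sum_ofFn] at h
  have hle := sum_swapLow_le hf
  have hch : (m + 1).choose 2 = m + m.choose 2 := by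
    rw [Nat.choose_succ_succ' m 1, Nat.choose_one_right]
  simp only [Function.comp_apply] at h
  simp only [areaL, h, hch]
  omega

theorem areaU_simpleFact {m : ℕ} {f : Fin m → Perm (Fin (m + 1))} (hf : f ∈ FactSet m) {k : ℕ}
    (hk : k ≤ m) : areaU (simpleFact f k) = areaU f + (k + 1) := by
  have h := sum_swapHigh_simpleList (isSwap_of_mem_ofFn hf) (k := k) (by simpa using hk)
  rw [← ofFn_simpleFact, List.map_ofFn, List.map_ofFn, List.sum_ofFn, List.sum_ofFn] at h
  have hle := choose_le_sum_swapHigh hf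
  have hch : (m + 1).choose 2 = m + m.choose 2 := by
    rw [Nat.choose_succ_succ' m 1, Nat.choose_one_right]
  simp only [Function.comp_apply] at h
  simp only [areaU, h, hch]
  omega

theorem bijective_simpleFact (m : ℕ) :
    Function.Bijective (fun p : Fin (m + 1) × {f : Fin m → Perm (Fin (m + 1)) // f ∈ FactSet m} =>
      (⟨simpleFact p.2.1 p.1, simpleFact_mem p.2.2 p.1⟩ :
        {f : Fin (m + 1) → Perm (Fin (m + 2)) //
          f ∈ FactSet (m + 1) ∧ ∃ i, f i = swap 0 (Fin.last (m + 1))})) := by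
  constructor
  · rintro ⟨k, f, hf⟩ ⟨k', f', hf'⟩ h
    have h := congrArg List.ofFn (Subtype.ext_iff.1 h)
    simp only [ofFn_simpleFact] at h
    obtain ⟨hl, hk⟩ := simpleList_inj (by simpa using k.is_le) (by simpa using k'.is_le) h
    simp only [Prod.mk.injEq, Subtype.mk.injEq]
    exact ⟨Fin.ext hk, List.ofFn_injective hl⟩
  · rintro ⟨g, ⟨hswap, hprod⟩, hmem⟩
    obtain ⟨l, k, hlen, hk, hl, hlprod, hg⟩ := exists_simpleList_eq (g := List.ofFn g) (by simp)
      (List.forall_mem_ofFn_iff.2 hswap) hprod ((List.mem_ofFn' _ _).2 hmem)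
    have hofFn : List.ofFn (fun i : Fin m => l[i.val]) = l := by
      apply List.ext_getElem <;> simp [hlen]
    refine ⟨⟨⟨k, by omega⟩, fun i => l[i.val], fun i => hl _ (List.getElem_mem _), ?_⟩, ?_⟩
    · rw [hofFn, hlprod]
    · apply Subtype.ext
      apply List.ofFn_injective
      exact (ofFn_simpleFact _ k).trans ((congrArg (simpleList · k) hofFn).trans hg)

/-- For `n ≥ 1`, the area enumerator of simple factorizations satisfies
`Ĥ_n(q,t) = t · (t^{n-1} + t^{n-2}q + ⋯ + q^{n-1}) · F_{n-1}(q,t)`. -/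
theorem Hpoly_eq (n : ℕ) (hn : 1 ≤ n) :
    Hpoly n = X 1 * (∑ j ∈ Finset.range n, X 1 ^ (n - 1 - j) * X 0 ^ j) * Fpoly (n-1) := by
  obtain ⟨m, rfl⟩ : ∃ m, n = m + 1 := ⟨n - 1, by omega⟩
  rw [Hpoly, ← (bijective_simpleFact m).sum_comp, Fintype.sum_prod_type, Nat.add_sub_cancel,
    ← Finset.sum_range_reflect, ← Fin.sum_univ_eq_sum_range
      (fun k => (X 1 ^ (m - (m + 1 - 1 - k)) * X 0 ^ (m + 1 - 1 - k) : MvPolynomial (Fin 2) ℤ)),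
    Finset.mul_sum, Finset.sum_mul]
  refine Finset.sum_congr rfl fun k _ => ?_
  rw [Fpoly, Finset.mul_sum]
  refine Finset.sum_congr rfl fun f _ => ?_
  have hk : m - (m + 1 - 1 - k.val) = k := by omega
  rw [areaL_simpleFact f.2 k.is_le, areaU_simpleFact f.2 k.is_le, hk, Nat.add_sub_cancel]
  ring
end

section
/- For every n ≥ 1, the maximum value of the total difference diff(f) over f ∈ F_n equals C(n+1,2), and the factorizations attaining this maximum satisfy ∑_{f ∈ F_n, diff(f) = C(n+1,2)} q^{area_L(f)} t^{area_U(f)} = t^n · ∏_{i=1}^{n} (t^{i−1} + t^{i−2}q + ⋯ + q^{i−1}), i.e. t^n times the q,t-inversion polynomial ∏_{i=1}^n (t^i − q^i)/(t − q) of permutations. -/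
open Finset MvPolynomial

attribute [local instance] Classical.propDecidable

/-- The total difference `diff(f) = ∑ (bᵢ - aᵢ)` of a factorization. -/
def tdiff {n : ℕ} (f : Fin n → Equiv.Perm (Fin (n+1))) : ℕ :=
  ∑ i, (swapHigh (f i) - swapLow (f i))

open Equiv in
lemma exists_invariant_of_card_lt {N : ℕ} {ι : Type*} [Fintype ι] (V : Finset (Fin N))
    (τ : ι → Perm (Fin N)) (hτ : ∀ i, (τ i).IsSwap) (hc : V.card + Fintype.card ι < N) :
    ∃ φ : Fin N → ℚ, φ ≠ 0 ∧ (∀ v ∈ V, φ v = 0) ∧ ∀ i z, φ (τ i z) = φ z := by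
  choose x y _ hxy using hτ
  let F : (Fin N → ℚ) →ₗ[ℚ] (V → ℚ) × (ι → ℚ) :=
    LinearMap.prod
      (LinearMap.pi fun v : V => LinearMap.proj (R := ℚ) (φ := fun _ : Fin N => ℚ) v.1)
      (LinearMap.pi fun i : ι => LinearMap.proj (R := ℚ) (φ := fun _ : Fin N => ℚ) (x i) -
        LinearMap.proj (R := ℚ) (φ := fun _ : Fin N => ℚ) (y i))
  have hF : LinearMap.ker F ≠ ⊥ := by
    apply LinearMap.ker_ne_bot_of_finrank_lt
    simpa using hc
  obtain ⟨φ, hφ, hne⟩ := (Submodule.ne_bot_iff _).1 hF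
  have h : (∀ v : V, φ v = 0) ∧ ∀ i, φ (x i) = φ (y i) := by
    have h0 : F φ = 0 := hφ
    refine ⟨fun v => congrFun (congrArg Prod.fst h0) v, fun i => ?_⟩
    exact sub_eq_zero.1 (congrFun (congrArg Prod.snd h0) i)
  refine ⟨φ, hne, fun v hv => h.1 ⟨v, hv⟩, fun i z => ?_⟩
  rw [hxy i, swap_apply_def]
  split_ifs with h1 h2
  · rw [h1, h.2]
  · rw [h2, h.2]
  · rfl

lemma apply_list_prod_eq {α β : Type*} (φ : α → β) (L : List (Equiv.Perm α))
    (h : ∀ τ ∈ L, ∀ z, φ (τ z) = φ z) (z : α) : φ (L.prod z) = φ z := by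
  induction L with
  | nil => rfl
  | cons a l ih =>
    rw [List.prod_cons, Equiv.Perm.mul_apply, h a (by simp),
      ih fun τ hτ => h τ (List.mem_cons_of_mem _ hτ)]

open Equiv in
lemma isSwap_conj {α : Type*} [DecidableEq α] (σ τ : Perm α) (h : τ.IsSwap) :
    (σ⁻¹ * τ * σ).IsSwap := by
  obtain ⟨x, y, hxy, rfl⟩ := h
  refine ⟨σ⁻¹ x, σ⁻¹ y, by simpa using hxy, ?_⟩
  rw [swap_apply_apply, inv_inv]

open Equiv in
lemma exists_prod_eq_of_sublist {α : Type*} [DecidableEq α] {S L : List (Perm α)}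
    (h : S.Sublist L) (hL : ∀ τ ∈ L, τ.IsSwap) :
    ∃ L' : List (Perm α), (∀ τ ∈ L', τ.IsSwap) ∧ L'.length + S.length = L.length ∧
      L.prod = S.prod * L'.prod := by
  induction h with
  | slnil => exact ⟨[], by simp, by simp, by simp⟩
  | @cons S l a _ ih =>
    obtain ⟨L', h1, h2, h3⟩ := ih fun τ hτ => hL τ (List.mem_cons_of_mem _ hτ)
    refine ⟨(S.prod⁻¹ * a * S.prod) :: L', ?_, by simp; omega, ?_⟩
    · intro τ hτ
      rcases List.mem_cons.1 hτ with rfl | hτ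
      · exact isSwap_conj _ _ (hL _ (by simp))
      · exact h1 _ hτ
    · rw [List.prod_cons, List.prod_cons, h3]; group
  | @cons_cons S l a _ ih =>
    obtain ⟨L', h1, h2, h3⟩ := ih fun τ hτ => hL τ (List.mem_cons_of_mem _ hτ)
    exact ⟨L', h1, by simp; omega, by simp [h3, mul_assoc]⟩

lemma swap_low_high {m : ℕ} {x y : Fin m} (h : x < y) :
    swapLow (Equiv.swap x y) = x ∧ swapHigh (Equiv.swap x y) = y := by
  have hs : (Equiv.swap x y).support.image Fin.val = {(x : ℕ), (y : ℕ)} := by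
    rw [Equiv.Perm.support_swap h.ne, Finset.image_insert, Finset.image_singleton]
  have h' : (x : ℕ) < y := h
  constructor
  · have : ((Equiv.swap x y).support.image Fin.val).min = ((x : ℕ) : WithTop ℕ) := by
      rw [hs, Finset.min_insert, Finset.min_singleton]
      exact min_eq_left (by exact_mod_cast h'.le)
    rw [swapLow, this]; rfl
  · have : ((Equiv.swap x y).support.image Fin.val).max = ((y : ℕ) : WithBot ℕ) := by
      rw [hs, Finset.max_insert, Finset.max_singleton]
      exact max_eq_right (by exact_mod_cast h'.le)
    rw [swapHigh, this]; rfl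

lemma exists_swap_eq {m : ℕ} {τ : Equiv.Perm (Fin m)} (h : τ.IsSwap) :
    ∃ x y : Fin m, x < y ∧ τ = Equiv.swap x y ∧ swapLow τ = x ∧ swapHigh τ = y := by
  obtain ⟨x, y, hxy, rfl⟩ := h
  rcases lt_or_gt_of_ne hxy with h | h
  · exact ⟨x, y, h, rfl, swap_low_high h⟩
  · exact ⟨y, x, h, Equiv.swap_comm x y, by rw [Equiv.swap_comm]; exact swap_low_high h⟩

lemma mem_factSet_iff {n : ℕ} (f : Fin n → Equiv.Perm (Fin (n+1))) :
    f ∈ FactSet n ↔ (∀ i, (f i).IsSwap) ∧ (List.ofFn f).prod = (finRotate (n+1))⁻¹ := by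
  refine and_congr_right fun h => ?_
  have : (List.ofFn f).prod⁻¹ = ((List.ofFn f).reverse).prod := by
    rw [List.prod_inv_reverse, List.map_congr_left (g := id), List.map_id]
    intro τ hτ
    obtain ⟨i, rfl⟩ := List.mem_ofFn.1 hτ
    obtain ⟨x, y, _, hxy⟩ := h i
    rw [hxy]; simp
  rw [← this, inv_eq_iff_eq_inv]

lemma pair_sublist_ofFn {α : Type*} {n : ℕ} (f : Fin n → α) {i j : Fin n} (h : i < j) :
    List.Sublist [f i, f j] (List.ofFn f) := by
  induction n with
  | zero => exact i.elim0
  | succ n ih =>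
    rw [List.ofFn_succ]
    obtain ⟨j, rfl⟩ := Fin.exists_succ_eq.2 (Fin.ne_zero_of_lt h)
    cases i using Fin.cases with
    | zero =>
      exact List.Sublist.cons_cons _ (List.singleton_sublist.2 (List.mem_ofFn.2 ⟨j, rfl⟩))
    | succ i => exact (ih (fun i => f i.succ) (Fin.succ_lt_succ_iff.1 h)).cons _

/-- Two edges `(a b)`, `(c d)` taken in this order satisfy `Compat` if they do not cross and, when
they share a vertex, turn around it in the direction of the full cycle. -/
def Compat (a b c d : ℕ) : Prop :=
  ¬ (a < c ∧ c < b ∧ b < d) ∧ ¬ (c < a ∧ a < d ∧ d < b) ∧ ¬ (a = c ∧ d ≤ b) ∧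
    ¬ (b = d ∧ c ≤ a) ∧ b ≠ c

lemma eq_of_forall_succ_eq {ψ : ℕ → ℚ} {l r : ℕ} (h : ∀ w, l ≤ w → w < r → ψ (w + 1) = ψ w) :
    ∀ w, l ≤ w → w ≤ r → ψ w = ψ l := by
  intro w hl
  induction w, hl using Nat.le_induction with
  | base => intro _; rfl
  | succ w hw ih => intro hr; rw [h w hw (by omega), ih (by omega)]

lemma const_of_not_compat {ψ : ℕ → ℚ} {n a b c d : ℕ} (hab : a < b) (hcd : c < d)
    (hb : b ≤ n) (hd : d ≤ n) (h0 : ψ (n + 1) = ψ 0)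
    (hψ : ∀ w ≤ n, ψ (w + 1) = ψ (Equiv.swap c d (Equiv.swap a b w)))
    (hc : ¬ Compat a b c d) : ∀ w ≤ n, ψ w = ψ 0 := by
  have hA := hψ a (by omega)
  have hB := hψ b (by omega)
  have hC := hψ c (by omega)
  have hD := hψ d (by omega)
  have hne : ∀ w ≤ n, w ≠ a → w ≠ b → w ≠ c → w ≠ d → ψ (w + 1) = ψ w := by
    intro w hw h1 h2 h3 h4
    rw [hψ w hw, Equiv.swap_apply_of_ne_of_ne h1 h2, Equiv.swap_apply_of_ne_of_ne h3 h4]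
  have key : ∀ l r, r ≤ n + 1 → (∀ w, l ≤ w → w < r → w ≠ a ∧ w ≠ b ∧ w ≠ c ∧ w ≠ d) →
      ∀ w, l ≤ w → w ≤ r → ψ w = ψ l := fun l r hr h =>
    eq_of_forall_succ_eq fun w hl hr' => by
      obtain ⟨h1, h2, h3, h4⟩ := h w hl hr'
      exact hne w (by omega) h1 h2 h3 h4
  have hcases : (a < c ∧ c < b ∧ b < d) ∨ (c < a ∧ a < d ∧ d < b) ∨ (a = c ∧ d < b) ∨
      (b = d ∧ c < a) ∨ b = c ∨ (a = c ∧ b = d) := by unfold Compat at hc; omega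
  clear hc hψ
  rcases hcases with h | h | ⟨rfl, h⟩ | ⟨rfl, h⟩ | rfl | ⟨rfl, rfl⟩
  · have k0 := key 0 a (by omega) (by omega)
    have k1 := key (a + 1) c (by omega) (by omega)
    have k2 := key (c + 1) b (by omega) (by omega)
    have k3 := key (b + 1) d (by omega) (by omega)
    have k4 := key (d + 1) (n + 1) (by omega) (by omega)
    have e0 := k0 a (by omega) (by omega)
    have e1 := k1 c (by omega) (by omega)
    have e2 := k2 b (by omega) (by omega)
    have e3 := k3 d (by omega) (by omega)
    have e4 := k4 (n + 1) (by omega) (by omega)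
    simp (disch := omega) only [Equiv.swap_apply_left, Equiv.swap_apply_right,
      Equiv.swap_apply_of_ne_of_ne] at hA hB hC hD
    intro w hw
    rcases Nat.lt_or_ge a w with h0 | h0
    on_goal 2 => linarith [k0 w (by omega) h0]
    rcases Nat.lt_or_ge c w with h1 | h1
    on_goal 2 => linarith [k1 w (by omega) h1]
    rcases Nat.lt_or_ge b w with h2 | h2
    on_goal 2 => linarith [k2 w (by omega) h2]
    rcases Nat.lt_or_ge d w with h3 | h3
    on_goal 2 => linarith [k3 w (by omega) h3]
    linarith [k4 w (by omega) (by omega)]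
  · have k0 := key 0 c (by omega) (by omega)
    have k1 := key (c + 1) a (by omega) (by omega)
    have k2 := key (a + 1) d (by omega) (by omega)
    have k3 := key (d + 1) b (by omega) (by omega)
    have k4 := key (b + 1) (n + 1) (by omega) (by omega)
    have e0 := k0 c (by omega) (by omega)
    have e1 := k1 a (by omega) (by omega)
    have e2 := k2 d (by omega) (by omega)
    have e3 := k3 b (by omega) (by omega)
    have e4 := k4 (n + 1) (by omega) (by omega)
    simp (disch := omega) only [Equiv.swap_apply_left, Equiv.swap_apply_right,
      Equiv.swap_apply_of_ne_of_ne] at hA hB hC hD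
    intro w hw
    rcases Nat.lt_or_ge c w with h0 | h0
    on_goal 2 => linarith [k0 w (by omega) h0]
    rcases Nat.lt_or_ge a w with h1 | h1
    on_goal 2 => linarith [k1 w (by omega) h1]
    rcases Nat.lt_or_ge d w with h2 | h2
    on_goal 2 => linarith [k2 w (by omega) h2]
    rcases Nat.lt_or_ge b w with h3 | h3
    on_goal 2 => linarith [k3 w (by omega) h3]
    linarith [k4 w (by omega) (by omega)]
  · have k0 := key 0 a (by omega) (by omega)
    have k1 := key (a + 1) d (by omega) (by omega)
    have k2 := key (d + 1) b (by omega) (by omega)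
    have k3 := key (b + 1) (n + 1) (by omega) (by omega)
    have e0 := k0 a (by omega) (by omega)
    have e1 := k1 d (by omega) (by omega)
    have e2 := k2 b (by omega) (by omega)
    have e3 := k3 (n + 1) (by omega) (by omega)
    simp (disch := omega) only [Equiv.swap_apply_left, Equiv.swap_apply_right,
      Equiv.swap_apply_of_ne_of_ne] at hA hB hC hD
    intro w hw
    rcases Nat.lt_or_ge a w with h0 | h0
    on_goal 2 => linarith [k0 w (by omega) h0]
    rcases Nat.lt_or_ge d w with h1 | h1
    on_goal 2 => linarith [k1 w (by omega) h1]
    rcases Nat.lt_or_ge b w with h2 | h2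
    on_goal 2 => linarith [k2 w (by omega) h2]
    linarith [k3 w (by omega) (by omega)]
  · have k0 := key 0 c (by omega) (by omega)
    have k1 := key (c + 1) a (by omega) (by omega)
    have k2 := key (a + 1) b (by omega) (by omega)
    have k3 := key (b + 1) (n + 1) (by omega) (by omega)
    have e0 := k0 c (by omega) (by omega)
    have e1 := k1 a (by omega) (by omega)
    have e2 := k2 b (by omega) (by omega)
    have e3 := k3 (n + 1) (by omega) (by omega)
    simp (disch := omega) only [Equiv.swap_apply_left, Equiv.swap_apply_right,
      Equiv.swap_apply_of_ne_of_ne] at hA hB hC hD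
    intro w hw
    rcases Nat.lt_or_ge c w with h0 | h0
    on_goal 2 => linarith [k0 w (by omega) h0]
    rcases Nat.lt_or_ge a w with h1 | h1
    on_goal 2 => linarith [k1 w (by omega) h1]
    rcases Nat.lt_or_ge b w with h2 | h2
    on_goal 2 => linarith [k2 w (by omega) h2]
    linarith [k3 w (by omega) (by omega)]
  · have k0 := key 0 a (by omega) (by omega)
    have k1 := key (a + 1) b (by omega) (by omega)
    have k2 := key (b + 1) d (by omega) (by omega)
    have k3 := key (d + 1) (n + 1) (by omega) (by omega)
    have e0 := k0 a (by omega) (by omega)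
    have e1 := k1 b (by omega) (by omega)
    have e2 := k2 d (by omega) (by omega)
    have e3 := k3 (n + 1) (by omega) (by omega)
    simp (disch := omega) only [Equiv.swap_apply_left, Equiv.swap_apply_right,
      Equiv.swap_apply_of_ne_of_ne] at hA hB hC hD
    intro w hw
    rcases Nat.lt_or_ge a w with h0 | h0
    on_goal 2 => linarith [k0 w (by omega) h0]
    rcases Nat.lt_or_ge b w with h1 | h1
    on_goal 2 => linarith [k1 w (by omega) h1]
    rcases Nat.lt_or_ge d w with h2 | h2
    on_goal 2 => linarith [k2 w (by omega) h2]
    linarith [k3 w (by omega) (by omega)]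
  · have k0 := key 0 a (by omega) (by omega)
    have k1 := key (a + 1) b (by omega) (by omega)
    have k2 := key (b + 1) (n + 1) (by omega) (by omega)
    have e0 := k0 a (by omega) (by omega)
    have e1 := k1 b (by omega) (by omega)
    have e2 := k2 (n + 1) (by omega) (by omega)
    simp (disch := omega) only [Equiv.swap_apply_left, Equiv.swap_apply_right] at hA hB hC hD
    intro w hw
    rcases Nat.lt_or_ge a w with h0 | h0
    on_goal 2 => linarith [k0 w (by omega) h0]
    rcases Nat.lt_or_ge b w with h1 | h1
    on_goal 2 => linarith [k1 w (by omega) h1]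
    linarith [k2 w (by omega) (by omega)]

lemma low_lt_high {m : ℕ} {τ : Equiv.Perm (Fin m)} (h : τ.IsSwap) : swapLow τ < swapHigh τ := by
  obtain ⟨x, y, hxy, -, h1, h2⟩ := exists_swap_eq h
  rw [h1, h2]; exact hxy

lemma high_lt {m : ℕ} {τ : Equiv.Perm (Fin m)} (h : τ.IsSwap) : swapHigh τ < m := by
  obtain ⟨x, y, hxy, -, h1, h2⟩ := exists_swap_eq h
  rw [h2]; exact y.2

lemma apply_eq_self_of_ne {m : ℕ} {τ : Equiv.Perm (Fin m)} (h : τ.IsSwap) {z : Fin m}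
    (h1 : (z : ℕ) ≠ swapLow τ) (h2 : (z : ℕ) ≠ swapHigh τ) : τ z = z := by
  obtain ⟨x, y, hxy, h3, h4, h5⟩ := exists_swap_eq h
  rw [h3, Equiv.swap_apply_of_ne_of_ne]
  · rintro rfl; exact h1 h4.symm
  · rintro rfl; exact h2 h5.symm

lemma eq_swap_of_low_high {m : ℕ} {τ : Equiv.Perm (Fin m)} (h : τ.IsSwap) {x y : Fin m}
    (h1 : swapLow τ = x) (h2 : swapHigh τ = y) : τ = Equiv.swap x y := by
  obtain ⟨x', y', hxy, h3, h4, h5⟩ := exists_swap_eq h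
  rw [h3, Fin.ext (h4.symm.trans h1), Fin.ext (h5.symm.trans h2)]

lemma const_of_finRotate {n : ℕ} {φ : Fin (n+1) → ℚ}
    (h : ∀ z, φ (finRotate (n+1) z) = φ z) (z : Fin (n+1)) : φ z = φ 0 := by
  induction z using Fin.induction with
  | zero => rfl
  | succ i ih =>
    rw [← ih, ← h i.castSucc, finRotate_apply, Fin.coeSucc_eq_succ]

theorem compat_of_lt {n : ℕ} {f : Fin n → Equiv.Perm (Fin (n+1))} (hf : f ∈ FactSet n)
    {i j : Fin n} (hij : i < j) :
    Compat (swapLow (f i)) (swapHigh (f i)) (swapLow (f j)) (swapHigh (f j)) := by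
  rw [mem_factSet_iff] at hf
  obtain ⟨hs, hp⟩ := hf
  obtain ⟨L, hL, hlen, hprod⟩ := exists_prod_eq_of_sublist (pair_sublist_ofFn f hij) (by
    intro τ hτ
    obtain ⟨k, rfl⟩ := List.mem_ofFn.1 hτ
    exact hs k)
  simp only [List.length_cons, List.length_nil, List.length_ofFn] at hlen
  obtain ⟨φ, hne, h0, hφ⟩ := exists_invariant_of_card_lt {(0 : Fin (n+1))} (fun i => L.get i)
    (fun i => hL _ (List.get_mem L i)) (by simp; omega)
  have hφ' := apply_list_prod_eq φ L (fun τ hτ => by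
    obtain ⟨k, rfl⟩ := List.mem_iff_get.1 hτ
    exact hφ k)
  obtain ⟨a, b, hab, hi, ha, hb⟩ := exists_swap_eq (hs i)
  obtain ⟨c, d, hcd, hj, hc, hd⟩ := exists_swap_eq (hs j)
  have hφs : ∀ w, φ (f j (f i w)) = φ (finRotate (n+1) w) := by
    intro w
    have h1 := hφ' (finRotate (n+1) w)
    have h2 : L.prod = f j * f i * (finRotate (n+1))⁻¹ := by
      rw [← hp, hprod, hi, hj]
      simp [← mul_assoc]
    rw [h2] at h1
    simpa using h1
  by_contra hcon
  rw [ha, hb, hc, hd] at hcon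
  apply hne
  let ψ : ℕ → ℚ := fun w => if h : w < n + 1 then φ ⟨w, h⟩ else φ 0
  have hψ : ∀ z : Fin (n+1), ψ z = φ z := fun z => by simp only [ψ, z.2, dite_true]
  have hswap : ∀ x y z : Fin (n+1), ((Equiv.swap x y z : Fin (n+1)) : ℕ) =
      Equiv.swap (x : ℕ) y z := by
    intro x y z
    simp only [Equiv.swap_apply_def, Fin.ext_iff]
    split_ifs <;> rfl
  have hconst := const_of_not_compat (ψ := ψ) (n := n) (show (a : ℕ) < b from hab)
    (show (c : ℕ) < d from hcd) (by omega) (by omega) (by simp [ψ]) (fun w hw => by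
      have h1 := hφs ⟨w, by omega⟩
      rw [hi, hj, ← hψ, hswap, hswap] at h1
      rw [h1]
      rcases hw.lt_or_eq with h | rfl
      · rw [finRotate_of_lt h]; simp [ψ, h]
      · rw [finRotate_last']; simp [ψ]) hcon
  funext z
  rw [← hψ, hconst z (by omega)]
  simpa [ψ] using h0 0 (by simp)

lemma card_len_ge {n : ℕ} {f : Fin n → Equiv.Perm (Fin (n+1))} (hf : f ∈ FactSet n)
    {d : ℕ} (hd : d ≤ n) :
    (Finset.univ.filter fun i => d ≤ swapHigh (f i) - swapLow (f i)).card ≤ n + 1 - d := by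
  have hs := hf.1
  set S := Finset.univ.filter fun i => d ≤ swapHigh (f i) - swapLow (f i) with hS
  rcases S.eq_empty_or_nonempty with h | h
  · rw [h]; simp
  obtain ⟨i, hi, hmin⟩ := Finset.exists_min_image S (fun i => swapHigh (f i) - swapLow (f i)) h
  have hiS : d ≤ swapHigh (f i) - swapLow (f i) := by simpa [hS] using hi
  by_contra! hlt
  let V : Finset (Fin (n+1)) :=
    Finset.univ.filter fun z => ¬ (swapLow (f i) < z ∧ (z : ℕ) < swapHigh (f i))
  have hV : V.card + (d - 1) ≤ n + 1 := by
    have h1 : (Finset.univ.filter fun z : Fin (n+1) =>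
        swapLow (f i) < z ∧ (z : ℕ) < swapHigh (f i)).card ≥ d - 1 := by
      have h2 : (Finset.Ioo (swapLow (f i)) (swapHigh (f i))).card ≥ d - 1 := by
        rw [Nat.card_Ioo]; omega
      refine h2.trans ?_
      rw [← Finset.card_map Fin.valEmbedding]
      refine Finset.card_le_card fun z hz => ?_
      rw [Finset.mem_Ioo] at hz
      have := high_lt (hs i)
      exact Finset.mem_map.2 ⟨⟨z, by omega⟩, by simpa using hz, rfl⟩
    have h2 := Finset.card_filter_add_card_filter_not (s := (Finset.univ : Finset (Fin (n+1))))
      (fun z : Fin (n+1) => swapLow (f i) < z ∧ (z : ℕ) < swapHigh (f i))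
    rw [Finset.card_univ, Fintype.card_fin] at h2
    change _ + V.card = _ at h2
    omega
  obtain ⟨φ, hne, h0, hφ⟩ := exists_invariant_of_card_lt V
    (fun k : {k // k ∉ S} => f k) (fun k => hs k) (by
      have h1 : Fintype.card {k // k ∉ S} = n - S.card := by
        rw [Fintype.card_subtype_compl]; simp
      have h2 : S.card ≤ n := by simpa using Finset.card_le_univ S
      rw [h1]; omega)
  have hout : ∀ k ∈ S, ∀ z : Fin (n+1), ((z : ℕ) = swapLow (f k) ∨ (z : ℕ) = swapHigh (f k)) →
      z ∈ V := by
    intro k hk z hz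
    have h1 := hmin k hk
    have h2 := low_lt_high (hs k)
    have h3 := low_lt_high (hs i)
    simp only [V, Finset.mem_filter, Finset.mem_univ, true_and]
    intro h4
    rcases lt_trichotomy i k with h | rfl | h
    · have := compat_of_lt hf h
      unfold Compat at this; omega
    · omega
    · have := compat_of_lt hf h
      unfold Compat at this; omega
  have hall : ∀ k z, φ (f k z) = φ z := by
    intro k z
    by_cases hk : k ∈ S
    · obtain ⟨x, y, hxy, h1, h2, h3⟩ := exists_swap_eq (hs k)
      have hx := h0 x (hout k hk x (Or.inl h2.symm))
      have hy := h0 y (hout k hk y (Or.inr h3.symm))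
      rw [h1, Equiv.swap_apply_def]
      split_ifs with h4 h5
      · rw [h4, hx, hy]
      · rw [h5, hx, hy]
      · rfl
    · exact hφ ⟨k, hk⟩ z
  have hrot : ∀ z, φ (finRotate (n+1) z) = φ z := by
    intro z
    rw [← hf.2]
    refine apply_list_prod_eq φ _ (fun τ hτ => ?_) z
    obtain ⟨k, rfl⟩ := List.mem_ofFn.1 (List.mem_reverse.1 hτ)
    exact hall k
  apply hne
  funext z
  obtain ⟨x, y, hxy, h1, h2, h3⟩ := exists_swap_eq (hs i)
  have hx := h0 x (hout i hi x (Or.inl h2.symm))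
  rw [const_of_finRotate hrot z, ← const_of_finRotate hrot x, hx]
  rfl

lemma tdiff_eq_sum_card {n : ℕ} {f : Fin n → Equiv.Perm (Fin (n+1))} (hf : f ∈ FactSet n) :
    tdiff f = ∑ e ∈ Finset.range n,
      (Finset.univ.filter fun i => e + 1 ≤ swapHigh (f i) - swapLow (f i)).card := by
  simp only [Finset.card_filter]
  rw [Finset.sum_comm, tdiff]
  refine Finset.sum_congr rfl fun i _ => ?_
  rw [← Finset.card_filter]
  have h1 := high_lt (hf.1 i)
  have : (Finset.range n).filter (fun e => e + 1 ≤ swapHigh (f i) - swapLow (f i)) =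
      Finset.range (swapHigh (f i) - swapLow (f i)) := by
    ext e; simp; omega
  rw [this, Finset.card_range]

lemma sum_range_sub (n : ℕ) : ∑ e ∈ Finset.range n, (n - e) = (n + 1).choose 2 := by
  induction n with
  | zero => rfl
  | succ n ih =>
    rw [Finset.sum_range_succ', Nat.choose_succ_succ, ← ih, Nat.choose_one_right, add_comm]
    simp

lemma tdiff_le {n : ℕ} {f : Fin n → Equiv.Perm (Fin (n+1))} (hf : f ∈ FactSet n) :
    tdiff f ≤ (n + 1).choose 2 := by
  rw [tdiff_eq_sum_card hf, ← sum_range_sub]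
  refine Finset.sum_le_sum fun e he => ?_
  rw [Finset.mem_range] at he
  exact (card_len_ge hf (by omega)).trans (by omega)

lemma card_len_ge_of_tdiff_eq {n : ℕ} {f : Fin n → Equiv.Perm (Fin (n+1))} (hf : f ∈ FactSet n)
    (hmax : tdiff f = (n + 1).choose 2) {e : ℕ} (he : e < n) :
    (Finset.univ.filter fun i => e + 1 ≤ swapHigh (f i) - swapLow (f i)).card = n - e := by
  rw [tdiff_eq_sum_card hf, ← sum_range_sub] at hmax
  refine (Finset.sum_eq_sum_iff_of_le fun e he => ?_).1 hmax e (Finset.mem_range.2 he)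
  rw [Finset.mem_range] at he
  exact (card_len_ge hf (by omega)).trans (by omega)

open Equiv in
lemma viaEmbeddingHom_swap {α β : Type*} [DecidableEq α] [DecidableEq β] (ι : α ↪ β) (x y : α) :
    Perm.viaEmbeddingHom ι (swap x y) = swap (ι x) (ι y) := by
  ext z
  rw [Perm.viaEmbeddingHom_apply]
  by_cases hz : z ∈ Set.range ι
  · obtain ⟨w, rfl⟩ := hz
    rw [Perm.viaEmbedding_apply]
    simp only [swap_apply_def, ι.injective.eq_iff]
    split_ifs <;> rfl
  · rw [Perm.viaEmbedding_apply_of_notMem _ _ _ hz, swap_apply_of_ne_of_ne]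
    · rintro rfl; exact hz ⟨x, rfl⟩
    · rintro rfl; exact hz ⟨y, rfl⟩

/-- Extend a permutation by fixing the new largest point. -/
noncomputable def embLo (m : ℕ) : Equiv.Perm (Fin m) →* Equiv.Perm (Fin (m+1)) :=
  Equiv.Perm.viaEmbeddingHom Fin.castSuccEmb

/-- Shift a permutation up by one and fix the new smallest point. -/
noncomputable def embHi (m : ℕ) : Equiv.Perm (Fin m) →* Equiv.Perm (Fin (m+1)) :=
  Equiv.Perm.viaEmbeddingHom (Fin.succEmb m)

lemma embLo_swap {m : ℕ} (x y : Fin m) :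
    embLo m (Equiv.swap x y) = Equiv.swap x.castSucc y.castSucc :=
  viaEmbeddingHom_swap _ x y

lemma embHi_swap {m : ℕ} (x y : Fin m) :
    embHi m (Equiv.swap x y) = Equiv.swap x.succ y.succ :=
  viaEmbeddingHom_swap _ x y

lemma embLo_castSucc {m : ℕ} (τ : Equiv.Perm (Fin m)) (x : Fin m) :
    embLo m τ x.castSucc = (τ x).castSucc :=
  Equiv.Perm.viaEmbedding_apply τ Fin.castSuccEmb x

lemma embHi_succ {m : ℕ} (τ : Equiv.Perm (Fin m)) (x : Fin m) :
    embHi m τ x.succ = (τ x).succ :=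
  Equiv.Perm.viaEmbedding_apply τ (Fin.succEmb m) x

lemma embLo_last {m : ℕ} (τ : Equiv.Perm (Fin m)) : embLo m τ (Fin.last m) = Fin.last m :=
  Equiv.Perm.viaEmbedding_apply_of_notMem τ Fin.castSuccEmb _ (by
    rintro ⟨x, hx⟩; exact Fin.castSucc_ne_last x hx)

lemma embHi_zero {m : ℕ} (τ : Equiv.Perm (Fin m)) : embHi m τ 0 = 0 :=
  Equiv.Perm.viaEmbedding_apply_of_notMem τ (Fin.succEmb m) _ (by
    rintro ⟨x, hx⟩; exact Fin.succ_ne_zero x hx)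

lemma embLo_injective (m : ℕ) : Function.Injective (embLo m) :=
  Equiv.Perm.viaEmbeddingHom_injective _

lemma embHi_injective (m : ℕ) : Function.Injective (embHi m) :=
  Equiv.Perm.viaEmbeddingHom_injective _

lemma embLo_isSwap {m : ℕ} {τ : Equiv.Perm (Fin m)} (h : τ.IsSwap) :
    (embLo m τ).IsSwap ∧ swapLow (embLo m τ) = swapLow τ ∧
      swapHigh (embLo m τ) = swapHigh τ := by
  obtain ⟨x, y, hxy, rfl, h1, h2⟩ := exists_swap_eq h
  have hlt : x.castSucc < y.castSucc := hxy
  rw [embLo_swap, h1, h2]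
  exact ⟨⟨_, _, hlt.ne, rfl⟩, swap_low_high hlt⟩

lemma embHi_isSwap {m : ℕ} {τ : Equiv.Perm (Fin m)} (h : τ.IsSwap) :
    (embHi m τ).IsSwap ∧ swapLow (embHi m τ) = swapLow τ + 1 ∧
      swapHigh (embHi m τ) = swapHigh τ + 1 := by
  obtain ⟨x, y, hxy, rfl, h1, h2⟩ := exists_swap_eq h
  have hlt : x.succ < y.succ := Fin.succ_lt_succ_iff.2 hxy
  rw [embHi_swap, h1, h2]
  exact ⟨⟨_, _, hlt.ne, rfl⟩, swap_low_high hlt⟩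

lemma exists_embLo_eq {m : ℕ} {τ : Equiv.Perm (Fin (m+1))} (h : τ.IsSwap)
    (hm : swapHigh τ < m) : ∃ τ' : Equiv.Perm (Fin m), τ'.IsSwap ∧ embLo m τ' = τ := by
  obtain ⟨x, y, hxy, rfl, h1, h2⟩ := exists_swap_eq h
  have hy : (y : ℕ) < m := h2 ▸ hm
  have hx : (x : ℕ) < m := lt_trans hxy hy
  refine ⟨Equiv.swap ⟨x, hx⟩ ⟨y, hy⟩, ⟨_, _, ?_, rfl⟩, embLo_swap _ _⟩
  intro h; exact hxy.ne (Fin.ext (Fin.mk.inj h))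

lemma exists_embHi_eq {m : ℕ} {τ : Equiv.Perm (Fin (m+1))} (h : τ.IsSwap)
    (hm : 0 < swapLow τ) : ∃ τ' : Equiv.Perm (Fin m), τ'.IsSwap ∧ embHi m τ' = τ := by
  obtain ⟨x, y, hxy, rfl, h1, h2⟩ := exists_swap_eq h
  obtain ⟨x', rfl⟩ := Fin.exists_succ_eq.2 (show x ≠ 0 from fun h => by
    rw [h1, h] at hm; exact absurd hm (by simp))
  obtain ⟨y', rfl⟩ := Fin.exists_succ_eq.2 (Fin.ne_zero_of_lt hxy)
  refine ⟨Equiv.swap x' y', ⟨_, _, ?_, rfl⟩, embHi_swap _ _⟩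
  rintro rfl; exact lt_irrefl _ hxy

/-- The transposition `(0 n)`. -/
def longSwap (n : ℕ) : Equiv.Perm (Fin (n+1)) := Equiv.swap 0 (Fin.last n)

lemma longSwap_low_high {n : ℕ} (hn : 0 < n) :
    swapLow (longSwap n) = 0 ∧ swapHigh (longSwap n) = n := by
  have : (0 : Fin (n+1)) < Fin.last n := Fin.lt_def.2 (by simpa using hn)
  exact swap_low_high this

lemma longSwap_isSwap {n : ℕ} (hn : 0 < n) : (longSwap n).IsSwap :=
  ⟨0, Fin.last n, (Fin.lt_def.2 (by simpa using hn)).ne, rfl⟩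

lemma longSwap_inv (n : ℕ) : (longSwap n)⁻¹ = longSwap n := Equiv.swap_inv _ _

lemma finRotate_inv_eq_lo (n : ℕ) :
    (finRotate (n+2))⁻¹ = embLo (n+1) (finRotate (n+1))⁻¹ * longSwap (n+1) := by
  rw [map_inv, ← longSwap_inv, ← mul_inv_rev, inv_inj]
  refine Equiv.ext fun z => ?_
  rw [Equiv.Perm.mul_apply]
  induction z using Fin.lastCases with
  | last => rw [embLo_last, finRotate_last, longSwap, Equiv.swap_apply_right]
  | cast x =>
    rw [embLo_castSucc]
    induction x using Fin.lastCases with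
    | last =>
      rw [finRotate_last, longSwap, Fin.castSucc_zero, Equiv.swap_apply_left, finRotate_apply,
        Fin.coeSucc_eq_succ, Fin.succ_last]
    | cast x =>
      rw [finRotate_apply, finRotate_apply, Fin.coeSucc_eq_succ, Fin.coeSucc_eq_succ,
        longSwap, Equiv.swap_apply_of_ne_of_ne, Fin.succ_castSucc]
      · rw [← Fin.succ_castSucc]; exact Fin.succ_ne_zero _
      · exact Fin.castSucc_ne_last _

lemma finRotate_inv_eq_hi (n : ℕ) :
    (finRotate (n+2))⁻¹ = longSwap (n+1) * embHi (n+1) (finRotate (n+1))⁻¹ := by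
  rw [map_inv, ← longSwap_inv, ← mul_inv_rev, inv_inj]
  refine Equiv.ext fun z => ?_
  rw [Equiv.Perm.mul_apply]
  induction z using Fin.lastCases with
  | last => rw [longSwap, Equiv.swap_apply_right, embHi_zero, finRotate_last]
  | cast x =>
    rw [finRotate_apply, Fin.coeSucc_eq_succ]
    induction x using Fin.cases with
    | zero =>
      rw [Fin.castSucc_zero, longSwap, Equiv.swap_apply_left, ← Fin.succ_last, embHi_succ,
        finRotate_last]
    | succ x =>
      rw [longSwap, Equiv.swap_apply_of_ne_of_ne, ← Fin.succ_castSucc, embHi_succ,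
        finRotate_apply, Fin.coeSucc_eq_succ]
      · rw [← Fin.succ_castSucc]; exact Fin.succ_ne_zero _
      · exact Fin.castSucc_ne_last _

lemma insertNth_succ_eq_cons {α : Type*} {n : ℕ} (k : Fin (n+1)) (x : α) (g : Fin (n+1) → α) :
    (Fin.insertNth k.succ x g : Fin (n+2) → α) =
      Fin.cons (g 0) (Fin.insertNth k x (fun i => g i.succ) : Fin (n+1) → α) := by
  rw [Fin.insertNth_eq_iff]
  refine ⟨by simp, ?_⟩
  funext i
  cases i using Fin.cases <;> simp [Fin.removeNth]

lemma prod_ofFn_insertNth_right {M : Type*} [Monoid M] {n : ℕ} (k : Fin (n+1)) (x : M)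
    (g : Fin n → M) (h : ∀ i : Fin n, k ≤ i.castSucc → Commute x (g i)) :
    (List.ofFn (Fin.insertNth k x g : Fin (n+1) → M)).prod = (List.ofFn g).prod * x := by
  induction n with
  | zero =>
    have : k = 0 := Fin.fin_one_eq_zero k
    subst this
    simp
  | succ n ih =>
    cases k using Fin.cases with
    | zero =>
      rw [List.ofFn_succ, List.prod_cons]
      simp only [Fin.insertNth_zero', Fin.cons_zero, Fin.cons_succ]
      refine (Commute.list_prod_right _ _ fun y hy => ?_).eq
      obtain ⟨i, rfl⟩ := List.mem_ofFn.1 hy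
      exact h i (Fin.zero_le _)
    | succ k =>
      rw [insertNth_succ_eq_cons, List.ofFn_succ, List.ofFn_succ (f := g)]
      simp only [Fin.cons_zero, Fin.cons_succ, List.prod_cons]
      rw [ih k (fun i => g i.succ), mul_assoc]
      intro i hi
      exact h i.succ (by rw [← Fin.succ_castSucc]; exact Fin.succ_le_succ_iff.2 hi)

lemma prod_ofFn_insertNth_left {M : Type*} [Monoid M] {n : ℕ} (k : Fin (n+1)) (x : M)
    (g : Fin n → M) (h : ∀ i : Fin n, i.castSucc < k → Commute x (g i)) :
    (List.ofFn (Fin.insertNth k x g : Fin (n+1) → M)).prod = x * (List.ofFn g).prod := by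
  induction n with
  | zero =>
    have : k = 0 := Fin.fin_one_eq_zero k
    subst this
    simp
  | succ n ih =>
    cases k using Fin.cases with
    | zero =>
      rw [List.ofFn_succ, List.prod_cons]
      simp only [Fin.insertNth_zero', Fin.cons_zero, Fin.cons_succ]
    | succ k =>
      rw [insertNth_succ_eq_cons, List.ofFn_succ, List.ofFn_succ (f := g)]
      simp only [Fin.cons_zero, Fin.cons_succ, List.prod_cons]
      rw [ih k (fun i => g i.succ), ← mul_assoc, ← mul_assoc,
        (h 0 (by simp)).eq]
      intro i hi
      exact h i.succ (by rw [← Fin.succ_castSucc]; exact Fin.succ_lt_succ_iff.2 hi)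

/-- Insert the edge `(0 n+1)` at time `k`, keeping all other edges in place. -/
noncomputable def insLo {n : ℕ} (k : Fin (n+1)) (f : Fin n → Equiv.Perm (Fin (n+1))) :
    Fin (n+1) → Equiv.Perm (Fin (n+2)) :=
  Fin.insertNth k (longSwap (n+1)) fun i => embLo (n+1) (f i)

/-- Insert the edge `(0 n+1)` at time `k`, shifting all other edges up by one. -/
noncomputable def insHi {n : ℕ} (k : Fin (n+1)) (f : Fin n → Equiv.Perm (Fin (n+1))) :
    Fin (n+1) → Equiv.Perm (Fin (n+2)) :=
  Fin.insertNth k (longSwap (n+1)) fun i => embHi (n+1) (f i)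

lemma ofFn_map_prod {M N : Type*} [Monoid M] [Monoid N] (φ : M →* N) {n : ℕ} (f : Fin n → M) :
    (List.ofFn fun i => φ (f i)).prod = φ (List.ofFn f).prod := by
  rw [map_list_prod, List.map_ofFn]; rfl

lemma insLo_mem_iff {n : ℕ} {k : Fin (n+1)} {f : Fin n → Equiv.Perm (Fin (n+1))}
    (hs : ∀ i, (f i).IsSwap) (h : ∀ i : Fin n, k ≤ i.castSucc → swapLow (f i) ≠ 0) :
    insLo k f ∈ FactSet (n+1) ↔ f ∈ FactSet n := by
  have hs' : ∀ i, (insLo k f i).IsSwap := by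
    intro i
    induction i using Fin.succAboveCases k with
    | x => simpa [insLo] using longSwap_isSwap n.succ_pos
    | p i => simpa [insLo] using (embLo_isSwap (hs i)).1
  rw [mem_factSet_iff, mem_factSet_iff, and_iff_right hs', and_iff_right hs, insLo,
    prod_ofFn_insertNth_right, ofFn_map_prod, finRotate_inv_eq_lo, mul_left_inj,
    (embLo_injective _).eq_iff]
  intro i hi
  apply Equiv.Perm.Disjoint.commute
  intro z
  rw [or_iff_not_imp_right]
  intro hz
  obtain ⟨h1, h2, h3⟩ := embLo_isSwap (hs i)
  have h4 := h i hi
  have h5 := high_lt (hs i)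
  have h6 := low_lt_high (hs i)
  rw [← h2] at h4
  by_contra hz'
  refine hz (apply_eq_self_of_ne h1 ?_ ?_)
  all_goals
    intro h7
    refine hz' (apply_eq_self_of_ne (longSwap_isSwap n.succ_pos) ?_ ?_)
    · rw [(longSwap_low_high n.succ_pos).1]; omega
    · rw [(longSwap_low_high n.succ_pos).2]; omega

lemma insHi_mem_iff {n : ℕ} {k : Fin (n+1)} {f : Fin n → Equiv.Perm (Fin (n+1))}
    (hs : ∀ i, (f i).IsSwap) (h : ∀ i : Fin n, i.castSucc < k → swapHigh (f i) ≠ n) :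
    insHi k f ∈ FactSet (n+1) ↔ f ∈ FactSet n := by
  have hs' : ∀ i, (insHi k f i).IsSwap := by
    intro i
    induction i using Fin.succAboveCases k with
    | x => simpa [insHi] using longSwap_isSwap n.succ_pos
    | p i => simpa [insHi] using (embHi_isSwap (hs i)).1
  rw [mem_factSet_iff, mem_factSet_iff, and_iff_right hs', and_iff_right hs, insHi,
    prod_ofFn_insertNth_left, ofFn_map_prod, finRotate_inv_eq_hi, mul_right_inj,
    (embHi_injective _).eq_iff]
  intro i hi
  apply Equiv.Perm.Disjoint.commute
  intro z
  rw [or_iff_not_imp_right]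
  intro hz
  obtain ⟨h1, h2, h3⟩ := embHi_isSwap (hs i)
  have h4 := h i hi
  have h5 := high_lt (hs i)
  have h6 := low_lt_high (hs i)
  by_contra hz'
  refine hz (apply_eq_self_of_ne h1 ?_ ?_)
  all_goals
    intro h7
    refine hz' (apply_eq_self_of_ne (longSwap_isSwap n.succ_pos) ?_ ?_)
    · rw [(longSwap_low_high n.succ_pos).1]; omega
    · rw [(longSwap_low_high n.succ_pos).2]; omega

lemma sum_insLo {n : ℕ} (k : Fin (n+1)) {f : Fin n → Equiv.Perm (Fin (n+1))}
    (hs : ∀ i, (f i).IsSwap) :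
    ∑ i, swapLow (insLo k f i) = ∑ i, swapLow (f i) ∧
    ∑ i, swapHigh (insLo k f i) = ∑ i, swapHigh (f i) + (n + 1) := by
  rw [Fin.sum_univ_succAbove _ k, Fin.sum_univ_succAbove _ k]
  simp only [insLo, Fin.insertNth_apply_same, Fin.insertNth_apply_succAbove,
    fun i => (embLo_isSwap (hs i)).2.1, fun i => (embLo_isSwap (hs i)).2.2,
    longSwap_low_high n.succ_pos]
  omega

lemma sum_insHi {n : ℕ} (k : Fin (n+1)) {f : Fin n → Equiv.Perm (Fin (n+1))}
    (hs : ∀ i, (f i).IsSwap) :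
    ∑ i, swapLow (insHi k f i) = ∑ i, swapLow (f i) + n ∧
    ∑ i, swapHigh (insHi k f i) = ∑ i, swapHigh (f i) + n + (n + 1) := by
  rw [Fin.sum_univ_succAbove _ k, Fin.sum_univ_succAbove _ k]
  simp only [insHi, Fin.insertNth_apply_same, Fin.insertNth_apply_succAbove,
    fun i => (embHi_isSwap (hs i)).2.1, fun i => (embHi_isSwap (hs i)).2.2,
    longSwap_low_high n.succ_pos, Finset.sum_add_distrib, Finset.sum_const, Finset.card_univ,
    Fintype.card_fin, smul_eq_mul, mul_one]
  omega

lemma tdiff_add_sum_low {n : ℕ} {f : Fin n → Equiv.Perm (Fin (n+1))}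
    (hs : ∀ i, (f i).IsSwap) :
    tdiff f + ∑ i, swapLow (f i) = ∑ i, swapHigh (f i) := by
  rw [tdiff, ← Finset.sum_add_distrib]
  exact Finset.sum_congr rfl fun i _ => Nat.sub_add_cancel (low_lt_high (hs i)).le

lemma choose_succ_two (n : ℕ) : (n + 1).choose 2 = n.choose 2 + n := by
  rw [Nat.choose_succ_succ, Nat.choose_one_right, add_comm]

lemma tdiff_insLo {n : ℕ} (k : Fin (n+1)) {f : Fin n → Equiv.Perm (Fin (n+1))}
    (hs : ∀ i, (f i).IsSwap) (hs' : ∀ i, (insLo k f i).IsSwap) :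
    tdiff (insLo k f) = tdiff f + (n + 1) := by
  have h1 := sum_insLo k hs
  have h2 := tdiff_add_sum_low hs
  have h3 := tdiff_add_sum_low hs'
  omega

lemma tdiff_insHi {n : ℕ} (k : Fin (n+1)) {f : Fin n → Equiv.Perm (Fin (n+1))}
    (hs : ∀ i, (f i).IsSwap) (hs' : ∀ i, (insHi k f i).IsSwap) :
    tdiff (insHi k f) = tdiff f + (n + 1) := by
  have h1 := sum_insHi k hs
  have h2 := tdiff_add_sum_low hs
  have h3 := tdiff_add_sum_low hs'
  omega

/-- The factorizations of maximal total difference whose edge `(0 n)` occurs at time `k`. -/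
def MaxAt (n : ℕ) (k : Fin n) : Set (Fin n → Equiv.Perm (Fin (n+1))) :=
  {f | f ∈ FactSet n ∧ tdiff f = (n + 1).choose 2 ∧ f k = longSwap n}

/-- Extend a factorization with longest edge at time `j` by a new longest edge at time `k`. -/
noncomputable def extendAt {n : ℕ} (k : Fin (n+1)) (j : Fin n)
    (f : Fin n → Equiv.Perm (Fin (n+1))) : Fin (n+1) → Equiv.Perm (Fin (n+2)) :=
  if j.castSucc < k then insLo k f else insHi k f

lemma low_ne_zero_of_gt {n : ℕ} {f : Fin n → Equiv.Perm (Fin (n+1))} (hf : f ∈ FactSet n)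
    {i j : Fin n} (hj : f j = longSwap n) (hij : j < i) : swapLow (f i) ≠ 0 := by
  have h1 := compat_of_lt hf hij
  have h2 := high_lt (hf.1 i)
  rw [hj, (longSwap_low_high j.pos).1, (longSwap_low_high j.pos).2] at h1
  unfold Compat at h1
  omega

lemma high_ne_of_lt {n : ℕ} {f : Fin n → Equiv.Perm (Fin (n+1))} (hf : f ∈ FactSet n)
    {i j : Fin n} (hj : f j = longSwap n) (hij : i < j) : swapHigh (f i) ≠ n := by
  have h1 := compat_of_lt hf hij
  rw [hj, (longSwap_low_high j.pos).1, (longSwap_low_high j.pos).2] at h1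
  unfold Compat at h1
  omega

lemma extendAt_mem {n : ℕ} {k : Fin (n+1)} {j : Fin n} {f : Fin n → Equiv.Perm (Fin (n+1))}
    (hf : f ∈ MaxAt n j) : extendAt k j f ∈ MaxAt (n+1) k := by
  obtain ⟨h1, h2, h3⟩ := hf
  rw [extendAt]
  split_ifs with h
  · have hm : insLo k f ∈ FactSet (n+1) :=
      (insLo_mem_iff h1.1 fun i hi => low_ne_zero_of_gt h1 h3
        (Fin.castSucc_lt_castSucc_iff.1 (h.trans_le hi))).2 h1
    refine ⟨hm, ?_, by simp [insLo]⟩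
    rw [tdiff_insLo k h1.1 hm.1, h2, choose_succ_two (n+1)]
  · have hm : insHi k f ∈ FactSet (n+1) :=
      (insHi_mem_iff h1.1 fun i hi => high_ne_of_lt h1 h3
        (Fin.castSucc_lt_castSucc_iff.1 (hi.trans_le (not_lt.1 h)))).2 h1
    refine ⟨hm, ?_, by simp [insHi]⟩
    rw [tdiff_insHi k h1.1 hm.1, h2, choose_succ_two (n+1)]

lemma eq_longSwap {n : ℕ} {τ : Equiv.Perm (Fin (n+1))} (h : τ.IsSwap)
    (hn : n ≤ swapHigh τ - swapLow τ) : τ = longSwap n := by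
  have h1 := high_lt h
  have h2 := low_lt_high h
  exact eq_swap_of_low_high h (by rw [Fin.val_zero]; omega) (by rw [Fin.val_last]; omega)

lemma factSet_injective {n : ℕ} {f : Fin n → Equiv.Perm (Fin (n+1))} (hf : f ∈ FactSet n) :
    Function.Injective f := by
  have key : ∀ i j : Fin n, i < j → f i ≠ f j := by
    intro i j hij h
    have := compat_of_lt hf hij
    rw [h] at this
    unfold Compat at this; omega
  intro i j h
  rcases lt_trichotomy i j with h' | h' | h'
  · exact absurd h (key i j h')
  · exact h'
  · exact absurd h.symm (key j i h')

lemma exists_mem_maxAt {n : ℕ} (hn : 1 ≤ n) {f : Fin n → Equiv.Perm (Fin (n+1))}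
    (hf : f ∈ FactSet n) (hmax : tdiff f = (n + 1).choose 2) : ∃ k, f ∈ MaxAt n k := by
  have h := card_len_ge_of_tdiff_eq hf hmax (e := n - 1) (by omega)
  obtain ⟨k, hk⟩ := Finset.card_pos.1 (by rw [h]; omega)
  refine ⟨k, hf, hmax, eq_longSwap (hf.1 k) ?_⟩
  have := (Finset.mem_filter.1 hk).2
  omega

lemma exists_len_eq {n : ℕ} (hn : 1 ≤ n) {f : Fin (n+1) → Equiv.Perm (Fin (n+2))}
    (hf : f ∈ FactSet (n+1)) (hmax : tdiff f = (n + 2).choose 2) :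
    ∃ i, swapHigh (f i) - swapLow (f i) = n := by
  have h1 := card_len_ge_of_tdiff_eq hf hmax (e := n) (by omega)
  have h2 := card_len_ge_of_tdiff_eq hf hmax (e := n - 1) (by omega)
  by_contra! hne
  have : (Finset.univ.filter fun i => n - 1 + 1 ≤ swapHigh (f i) - swapLow (f i)) =
      Finset.univ.filter fun i => n + 1 ≤ swapHigh (f i) - swapLow (f i) := by
    ext i
    have := hne i
    simp only [Finset.mem_filter, Finset.mem_univ, true_and]
    omega
  rw [this] at h2
  omega

lemma exists_extendAt_eq {n : ℕ} (hn : 1 ≤ n) {k : Fin (n+1)}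
    {f : Fin (n+1) → Equiv.Perm (Fin (n+2))} (hf : f ∈ MaxAt (n+1) k) :
    ∃ j, ∃ f' ∈ MaxAt n j, extendAt k j f' = f := by
  obtain ⟨hf, hmax, hk⟩ := hf
  obtain ⟨i, hi⟩ := exists_len_eq hn hf hmax
  have hkl : swapLow (f k) = 0 ∧ swapHigh (f k) = n + 1 := by
    rw [hk]; exact longSwap_low_high n.succ_pos
  have hik : i ≠ k := by rintro rfl; omega
  obtain ⟨j, rfl⟩ := Fin.exists_succAbove_eq hik
  have hjs := hf.1 (k.succAbove j)
  have hj1 := high_lt hjs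
  have hj2 := low_lt_high hjs
  have hcomp : ∀ a b : Fin (n+1), a < b →
      Compat (swapLow (f a)) (swapHigh (f a)) (swapLow (f b)) (swapHigh (f b)) :=
    fun a b h => compat_of_lt hf h
  rcases Nat.eq_zero_or_pos (swapLow (f (k.succAbove j))) with h0 | h0
  · have hjk : k.succAbove j < k := by
      refine lt_of_le_of_ne (not_lt.1 fun h => ?_) hik
      have := hcomp _ _ h
      unfold Compat at this; omega
    have hother : ∀ i : Fin n, swapHigh (f (k.succAbove i)) < n + 1 := by
      intro i
      have h1 := high_lt (hf.1 (k.succAbove i))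
      have h2 := low_lt_high (hf.1 (k.succAbove i))
      by_contra h3
      have huk : k.succAbove i < k ∨ k < k.succAbove i :=
        lt_or_gt_of_ne (Fin.succAbove_ne k i)
      have huj : k.succAbove i < k.succAbove j ∨ k.succAbove i = k.succAbove j ∨
        k.succAbove j < k.succAbove i := lt_trichotomy _ _
      unfold Compat at hcomp
      rcases huj with h | h | h
      · have c1 := hcomp _ _ h
        have c2 := hcomp _ _ (h.trans hjk)
        omega
      · rw [h] at h3; omega
      · have c1 := hcomp _ _ h
        rcases huk with h' | h'
        · have c2 := hcomp _ _ h'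
          omega
        · have c2 := hcomp _ _ h'
          omega
    choose f' hs' hf' using fun i => exists_embLo_eq (hf.1 (k.succAbove i)) (hother i)
    have hins : insLo k f' = f := by
      rw [insLo, Fin.insertNth_eq_iff]
      exact ⟨hk.symm, funext hf'⟩
    have hjk' : j.castSucc < k := by
      by_contra h
      rw [Fin.succAbove_of_le_castSucc _ _ (not_lt.1 h)] at hjk
      exact absurd (hjk.trans_le (not_lt.1 h)) (by simp [Fin.lt_def])
    have hmem : f' ∈ FactSet n := by
      rw [← insLo_mem_iff (k := k) hs', hins]
      · exact hf
      · intro i hi h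
        rw [← (embLo_isSwap (hs' i)).2.1, hf'] at h
        have h1 := hcomp k (k.succAbove i) (by
          rw [Fin.succAbove_of_le_castSucc _ _ hi]
          exact Fin.le_castSucc_iff.1 hi)
        have h2 := hother i
        unfold Compat at h1; omega
    refine ⟨j, f', ⟨hmem, ?_, ?_⟩, ?_⟩
    · have := tdiff_insLo k hs' (by rw [hins]; exact hf.1)
      rw [hins, hmax, choose_succ_two (n+1)] at this
      omega
    · apply eq_longSwap (hs' j)
      have := embLo_isSwap (hs' j)
      rw [hf'] at this
      omega
    · rw [extendAt, if_pos hjk', hins]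
  · have hjk : k < k.succAbove j := by
      refine lt_of_le_of_ne (not_lt.1 fun h => ?_) hik.symm
      have := hcomp _ _ h
      unfold Compat at this; omega
    have hother : ∀ i : Fin n, 0 < swapLow (f (k.succAbove i)) := by
      intro i
      have h1 := high_lt (hf.1 (k.succAbove i))
      have h2 := low_lt_high (hf.1 (k.succAbove i))
      by_contra h3
      have huk : k.succAbove i < k ∨ k < k.succAbove i :=
        lt_or_gt_of_ne (Fin.succAbove_ne k i)
      have huj : k.succAbove i < k.succAbove j ∨ k.succAbove i = k.succAbove j ∨
        k.succAbove j < k.succAbove i := lt_trichotomy _ _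
      unfold Compat at hcomp
      rcases huj with h | h | h
      · have c1 := hcomp _ _ h
        rcases huk with h' | h'
        · have c2 := hcomp _ _ h'
          omega
        · have c2 := hcomp _ _ h'
          omega
      · rw [h] at h3; omega
      · have c1 := hcomp _ _ h
        rcases huk with h' | h'
        · have c2 := hcomp _ _ h'
          omega
        · have c2 := hcomp _ _ h'
          omega
    choose f' hs' hf' using fun i => exists_embHi_eq (hf.1 (k.succAbove i)) (hother i)
    have hins : insHi k f' = f := by
      rw [insHi, Fin.insertNth_eq_iff]
      exact ⟨hk.symm, funext hf'⟩
    have hjk' : ¬ j.castSucc < k := by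
      intro h
      rw [Fin.succAbove_of_castSucc_lt _ _ h] at hjk
      exact lt_asymm h hjk
    have hmem : f' ∈ FactSet n := by
      rw [← insHi_mem_iff (k := k) hs', hins]
      · exact hf
      · intro i hi h
        have h3 := (embHi_isSwap (hs' i)).2.2
        rw [hf'] at h3
        have h1 := hcomp (k.succAbove i) k (by
          rwa [Fin.succAbove_of_castSucc_lt _ _ hi])
        have h2 := hother i
        unfold Compat at h1; omega
    refine ⟨j, f', ⟨hmem, ?_, ?_⟩, ?_⟩
    · have := tdiff_insHi k hs' (by rw [hins]; exact hf.1)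
      rw [hins, hmax, choose_succ_two (n+1)] at this
      omega
    · apply eq_longSwap (hs' j)
      have := embHi_isSwap (hs' j)
      rw [hf'] at this
      omega
    · rw [extendAt, if_neg hjk', hins]

lemma extendAt_injective {n : ℕ} {k : Fin (n+1)} {j₁ j₂ : Fin n}
    {f₁ f₂ : Fin n → Equiv.Perm (Fin (n+1))} (h₁ : f₁ ∈ MaxAt n j₁) (h₂ : f₂ ∈ MaxAt n j₂)
    (h : extendAt k j₁ f₁ = extendAt k j₂ f₂) : j₁ = j₂ ∧ f₁ = f₂ := by
  have hne : ∀ f₁ f₂ : Fin n → Equiv.Perm (Fin (n+1)), (∀ i, (f₁ i).IsSwap) →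
      ∀ j, (f₂ j).IsSwap → f₂ j = longSwap n → insLo k f₁ ≠ insHi k f₂ := by
    intro f₁ f₂ hs₁ j hs₂ hj h
    have := congrFun h (k.succAbove j)
    simp only [insLo, insHi, Fin.insertNth_apply_succAbove] at this
    have h1 := (embLo_isSwap (hs₁ j)).2.2
    have h2 := (embHi_isSwap hs₂).2.2
    have h3 := high_lt (hs₁ j)
    rw [this, h2, hj, (longSwap_low_high j.pos).2] at h1
    omega
  have hf : f₁ = f₂ := by
    rw [extendAt, extendAt] at h
    split_ifs at h with c1 c2 c2
    · funext i
      have := congrFun h (k.succAbove i)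
      simp only [insLo, Fin.insertNth_apply_succAbove] at this
      exact embLo_injective _ this
    · exact absurd h (hne _ _ h₁.1.1 j₂ (h₂.1.1 _) h₂.2.2)
    · exact absurd h.symm (hne _ _ h₂.1.1 j₁ (h₁.1.1 _) h₁.2.2)
    · funext i
      have := congrFun h (k.succAbove i)
      simp only [insHi, Fin.insertNth_apply_succAbove] at this
      exact embHi_injective _ this
  subst hf
  exact ⟨factSet_injective h₁.1 (h₁.2.2.trans h₂.2.2.symm), rfl⟩

lemma sum_low_le {n : ℕ} (hn : 1 ≤ n) {k : Fin n} {f : Fin n → Equiv.Perm (Fin (n+1))}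
    (hf : f ∈ MaxAt n k) : ∑ i, swapLow (f i) ≤ n.choose 2 := by
  induction n, hn using Nat.le_induction with
  | base =>
    have := low_lt_high (hf.1.1 0)
    have := high_lt (hf.1.1 0)
    simp
    omega
  | succ n hn ih =>
    obtain ⟨j, f', hf', rfl⟩ := exists_extendAt_eq hn hf
    have h1 := ih hf'
    rw [choose_succ_two]
    unfold extendAt
    split_ifs
    · rw [(sum_insLo k hf'.1.1).1]; omega
    · rw [(sum_insHi k hf'.1.1).1]; omega

lemma area_extendAt {n : ℕ} (hn : 1 ≤ n) {k : Fin (n+1)} {j : Fin n}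
    {f : Fin n → Equiv.Perm (Fin (n+1))} (hf : f ∈ MaxAt n j) :
    areaL (extendAt k j f) = areaL f + (if j.castSucc < k then n else 0) ∧
    areaU (extendAt k j f) = areaU f + (if j.castSucc < k then 1 else n + 1) := by
  have h1 := sum_low_le hn hf
  have h2 := tdiff_add_sum_low hf.1.1
  have h3 := hf.2.1
  rw [choose_succ_two] at h3
  simp only [areaL, areaU, choose_succ_two n]
  unfold extendAt
  split_ifs
  · rw [(sum_insLo k hf.1.1).1, (sum_insLo k hf.1.1).2]; omega
  · rw [(sum_insHi k hf.1.1).1, (sum_insHi k hf.1.1).2]; omega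

/-- The weight enumerator of `MaxAt n k`. -/
noncomputable def enumAt (n : ℕ) (k : Fin n) : MvPolynomial (Fin 2) ℤ :=
  ∑ f ∈ Finset.univ.filter (· ∈ MaxAt n k), X 0 ^ areaL f * X 1 ^ areaU f

lemma enumAt_succ {n : ℕ} (hn : 1 ≤ n) (k : Fin (n+1)) :
    enumAt (n+1) k = ∑ j : Fin n,
      (X 0 ^ (if j.castSucc < k then n else 0) * X 1 ^ (if j.castSucc < k then 1 else n + 1)) *
        enumAt n j := by
  simp only [enumAt, Finset.mul_sum]
  rw [Finset.sum_sigma']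
  symm
  refine Finset.sum_bij (fun p _ => extendAt k p.1 p.2) ?_ ?_ ?_ ?_
  · rintro ⟨j, f⟩ hp
    simp only [Finset.mem_sigma, Finset.mem_filter, Finset.mem_univ, true_and] at hp ⊢
    exact extendAt_mem hp
  · rintro ⟨j₁, f₁⟩ h₁ ⟨j₂, f₂⟩ h₂ h
    simp only [Finset.mem_sigma, Finset.mem_filter, Finset.mem_univ, true_and] at h₁ h₂
    obtain ⟨rfl, rfl⟩ := extendAt_injective h₁ h₂ h
    rfl
  · intro f hf
    simp only [Finset.mem_filter, Finset.mem_univ, true_and] at hf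
    obtain ⟨j, f', hf', rfl⟩ := exists_extendAt_eq hn hf
    exact ⟨⟨j, f'⟩, by simpa using hf', rfl⟩
  · rintro ⟨j, f⟩ hp
    simp only [Finset.mem_sigma, Finset.mem_filter, Finset.mem_univ, true_and] at hp
    rw [(area_extendAt hn hp).1, (area_extendAt hn hp).2]
    ring

lemma sum_shift {R : Type*} [CommRing R] (q t : R) {n k : ℕ} (hk : k ≤ n) :
    (∑ j ∈ Finset.range n, (q ^ (if j < k then n else 0) * t ^ (if j < k then 1 else n + 1)) *
      (t ^ n * (t ^ (n - 1 - j) * q ^ j))) =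
    t ^ (n + 1) * (t ^ (n - k) * q ^ k) * ∑ j ∈ Finset.range n, t ^ (n - 1 - j) * q ^ j := by
  obtain ⟨m, rfl⟩ := Nat.exists_eq_add_of_le hk
  have h1 : ∑ j ∈ Finset.range (k + m), (q ^ (if j < k then k + m else 0) *
      t ^ (if j < k then 1 else k + m + 1)) * (t ^ (k + m) * (t ^ (k + m - 1 - j) * q ^ j)) =
      ∑ j ∈ Finset.range k, t ^ (k + m + 1) * (t ^ (k + m - 1 - j) * q ^ (k + m + j)) +
      ∑ j ∈ Finset.range m, t ^ (k + m + 1) * (t ^ (k + m + (m - 1 - j)) * q ^ (k + j)) := by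
    rw [Finset.sum_range_add]
    congr 1
    · refine Finset.sum_congr rfl fun j hj => ?_
      rw [if_pos (Finset.mem_range.1 hj), if_pos (Finset.mem_range.1 hj)]
      ring
    · refine Finset.sum_congr rfl fun j hj => ?_
      rw [if_neg (by omega), if_neg (by omega),
        show k + m - 1 - (k + j) = m - 1 - j by omega]
      ring
  rw [h1, add_comm k m, Finset.sum_range_add, mul_add, Finset.mul_sum, Finset.mul_sum, add_comm,
    Nat.add_sub_cancel]
  congr 1
  · refine Finset.sum_congr rfl fun j hj => ?_
    rw [Finset.mem_range] at hj
    rw [show m + k - 1 - j = k + (m - 1 - j) by omega]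
    ring
  · refine Finset.sum_congr rfl fun j hj => ?_
    rw [Finset.mem_range] at hj
    rw [show m + k - 1 - j = m + (k - 1 - j) by omega,
      show m + k - 1 - (m + j) = k - 1 - j by omega]
    ring

lemma mem_maxAt_one_iff {f : Fin 1 → Equiv.Perm (Fin 2)} :
    f ∈ MaxAt 1 0 ↔ f = fun _ => longSwap 1 := by
  constructor
  · intro h
    funext i
    rw [Fin.fin_one_eq_zero i]; exact h.2.2
  · rintro rfl
    have hs : (longSwap 1).IsSwap := longSwap_isSwap one_pos
    refine ⟨(mem_factSet_iff _).2 ⟨fun _ => hs, ?_⟩, ?_, rfl⟩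
    · rw [finRotate_inv_eq_lo 0, show finRotate (0 + 1) = 1 from finRotate_one, inv_one,
        map_one, one_mul]
      simp
    · simp [tdiff, longSwap_low_high one_pos]

lemma enumAt_eq {n : ℕ} (hn : 1 ≤ n) (k : Fin n) :
    enumAt n k = X 1 ^ n * (X 1 ^ (n - 1 - k) * X 0 ^ (k : ℕ)) *
      ∏ i ∈ Finset.range (n - 1), (∑ j ∈ Finset.range (i+1), X 1 ^ (i - j) * X 0 ^ j) := by
  induction n, hn using Nat.le_induction with
  | base =>
    have hk : k = 0 := Fin.fin_one_eq_zero k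
    subst hk
    have : (Finset.univ.filter (· ∈ MaxAt 1 0)) = {fun _ => longSwap 1} := by
      ext f
      simpa using mem_maxAt_one_iff
    rw [enumAt, this]
    simp [areaL, areaU, longSwap_low_high one_pos]
  | succ n hn ih =>
    rw [enumAt_succ hn]
    obtain ⟨m, rfl⟩ := Nat.exists_eq_add_of_le' hn
    simp only [ih, Fin.lt_def, Fin.val_castSucc]
    rw [Nat.add_sub_cancel, Nat.add_sub_cancel, Finset.prod_range_succ, mul_comm (Finset.prod _ _),
      ← mul_assoc]
    have h := sum_shift (X 0 : MvPolynomial (Fin 2) ℤ) (X 1) (n := m + 1) (k := k) (by omega)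
    rw [Nat.add_sub_cancel] at h
    rw [← h, Finset.sum_mul, ← Fin.sum_univ_eq_sum_range (fun j =>
      (X 0 ^ (if j < (k : ℕ) then m + 1 else 0) * X 1 ^ (if j < (k : ℕ) then 1 else m + 1 + 1)) *
      (X 1 ^ (m + 1) * (X 1 ^ (m - j) * X 0 ^ j)) *
      (∏ i ∈ Finset.range m, ∑ j ∈ Finset.range (i + 1), X 1 ^ (i - j) * X 0 ^ j :
        MvPolynomial (Fin 2) ℤ))]
    refine Finset.sum_congr rfl fun j _ => ?_
    ring

lemma maxAt_nonempty {n : ℕ} (hn : 1 ≤ n) : ∃ k f, f ∈ MaxAt n k := by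
  induction n, hn using Nat.le_induction with
  | base => exact ⟨0, fun _ => longSwap 1, mem_maxAt_one_iff.2 rfl⟩
  | succ n hn ih =>
    obtain ⟨k, f, hf⟩ := ih
    exact ⟨0, extendAt 0 k f, extendAt_mem hf⟩

/-- For `n ≥ 1`, the maximum of `diff` over `F_n` is `C(n+1,2)`, and
`∑_{f : diff f max} q^{area_L f} t^{area_U f}
  = tⁿ · ∏_{i=1}^{n} (t^{i-1} + t^{i-2}q + ⋯ + q^{i-1})`,
i.e. `tⁿ` times the `q,t`-inversion polynomial of permutations. -/
theorem max_tdiff_and_enumerator (n : ℕ) (hn : 1 ≤ n) :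
    IsGreatest {k : ℕ | ∃ f ∈ FactSet n, tdiff f = k} ((n+1).choose 2) ∧
    (∑ f : {f : Fin n → Equiv.Perm (Fin (n+1)) //
        f ∈ FactSet n ∧ tdiff f = (n+1).choose 2},
      (X 0 ^ areaL f.1 * X 1 ^ areaU f.1 : MvPolynomial (Fin 2) ℤ)) =
      X 1 ^ n * ∏ i ∈ Finset.range n,
        (∑ j ∈ Finset.range (i+1), X 1 ^ (i - j) * X 0 ^ j) := by
  constructor
  · refine ⟨?_, ?_⟩
    · obtain ⟨k, f, hf⟩ := maxAt_nonempty hn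
      exact ⟨f, hf.1, hf.2.1⟩
    · rintro _ ⟨f, hf, rfl⟩
      exact tdiff_le hf
  · have h1 : (∑ f : {f : Fin n → Equiv.Perm (Fin (n+1)) //
        f ∈ FactSet n ∧ tdiff f = (n+1).choose 2},
        (X 0 ^ areaL f.1 * X 1 ^ areaU f.1 : MvPolynomial (Fin 2) ℤ)) =
        ∑ k : Fin n, enumAt n k := by
      simp only [enumAt]
      rw [← Finset.sum_biUnion]
      · symm
        refine Finset.sum_subtype _ (fun f => ?_) _
        simp only [Finset.mem_biUnion, Finset.mem_filter, Finset.mem_univ, true_and]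
        exact ⟨fun ⟨k, hk⟩ => ⟨hk.1, hk.2.1⟩, fun h => exists_mem_maxAt hn h.1 h.2⟩
      · intro k₁ _ k₂ _ hne
        refine Finset.disjoint_left.2 fun f h₁ h₂ => hne ?_
        simp only [Finset.mem_filter, Finset.mem_univ, true_and] at h₁ h₂
        exact factSet_injective h₁.1 (h₁.2.2.trans h₂.2.2.symm)
    rw [h1]
    obtain ⟨m, rfl⟩ := Nat.exists_eq_add_of_le' hn
    simp only [enumAt_eq hn, Nat.add_sub_cancel]
    rw [Finset.prod_range_succ, ← Finset.sum_mul, ← Finset.mul_sum,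
      Fin.sum_univ_eq_sum_range
        (fun j => (X 1 ^ (m - j) * X 0 ^ j : MvPolynomial (Fin 2) ℤ)) (m + 1)]
    ring
end
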